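/- arXiv:2203.02509 — 2 statements merged into one kernel-verified Lean document; each statement's English description precedes it below -/
import Mathlib

section
/- Let a ∈ (0,1], λ ∈ (0,1), s ∈ ℂ, and let n ≥ 1 be an integer. For c > 0 with c ∉ {a+k : k ∈ ℤ}, define L(c) = e^{-iπ/4} ∫_{-∞}^{∞} [e^{-iπ w(ξ)² + 2πi w(ξ)(a+λ)} / (e^{iπ w(ξ) − 2πia} − e^{-iπ w(ξ)})] · w(ξ)^{-s} dξ with w(ξ) = c + e^{-iπ/4}ξ. Then for any c₁ with 0 < c₁ < a and any c₂ with a + n − 1 < c₂ < a + n, e^{-iπa(1+a+2λ)} · (L(c₁) − L(c₂)) = Σ_{k=0}^{n-1} e^{2πiλk} (a+k)^{-s}. In particular, displacing the contour across the n poles a, a+1, …, a+n−1 produces exactly the first n terms of the Lerch series. -/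
open Real Set
open Complex (I)

/-- The integral `L(c)` of the Lerch integrand along the straight line through `c > 0`
with direction `e^{-iπ/4}`, traversed from the second quadrant to the fourth:
`L(c) = e^{-iπ/4} ∫_ℝ e^{-iπw(ξ)² + 2πiw(ξ)(a+λ)}/(e^{iπw(ξ)-2πia} - e^{-iπw(ξ)}) w(ξ)^{-s} dξ`
with `w(ξ) = c + e^{-iπ/4}ξ`. -/
noncomputable def lerchContourIntegral (a lam : ℝ) (s : ℂ) (c : ℝ) : ℂ :=
  Complex.exp (-(I * (π : ℂ) / 4)) *
    ∫ ξ : ℝ,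
      Complex.exp (-(I * (π : ℂ) * ((c : ℂ) + Complex.exp (-(I * (π : ℂ) / 4)) * (ξ : ℂ)) ^ 2)
          + 2 * (π : ℂ) * I * ((c : ℂ) + Complex.exp (-(I * (π : ℂ) / 4)) * (ξ : ℂ))
              * ((a : ℂ) + (lam : ℂ))) /
        (Complex.exp (I * (π : ℂ) * ((c : ℂ) + Complex.exp (-(I * (π : ℂ) / 4)) * (ξ : ℂ))
              - 2 * (π : ℂ) * I * (a : ℂ))
          - Complex.exp (-(I * (π : ℂ)
              * ((c : ℂ) + Complex.exp (-(I * (π : ℂ) / 4)) * (ξ : ℂ))))) *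
        ((c : ℂ) + Complex.exp (-(I * (π : ℂ) / 4)) * (ξ : ℂ)) ^ (-s)

open Filter Topology MeasureTheory

/-- The boundary integral of `(z - p)⁻¹` over a rectangle containing `p` in its interior. -/
theorem integral_boundary_rect_inv_sub {p : ℂ} {x₀ x₁ y₀ y₁ : ℝ} (hx₀ : x₀ < p.re)
    (hx₁ : p.re < x₁) (hy₀ : y₀ < p.im) (hy₁ : p.im < y₁) :
    (∫ x : ℝ in x₀..x₁, ((x : ℂ) + y₀ * I - p)⁻¹) - (∫ x : ℝ in x₀..x₁, ((x : ℂ) + y₁ * I - p)⁻¹) +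
      I * (∫ y : ℝ in y₀..y₁, ((x₁ : ℂ) + y * I - p)⁻¹) -
      I * (∫ y : ℝ in y₀..y₁, ((x₀ : ℂ) + y * I - p)⁻¹) = 2 * π * I := by
  have horiz : ∀ (u : ℂ) (y : ℝ), u ≠ 0 → (∀ x : ℝ, 0 < (u * (x + y * I - p)).re) →
      (∫ x : ℝ in x₀..x₁, ((x : ℂ) + y * I - p)⁻¹) =
        Complex.log (u * (x₁ + y * I - p)) - Complex.log (u * (x₀ + y * I - p)) := by
    intro u y hu h
    have hne (x : ℝ) : (x : ℂ) + y * I - p ≠ 0 := fun h0 => by simpa [h0] using h x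
    refine intervalIntegral.integral_eq_sub_of_hasDerivAt
      (f := fun x : ℝ => Complex.log (u * (x + y * I - p))) (fun x _ => ?_)
      (ContinuousOn.intervalIntegrable (Continuous.continuousOn
        (Continuous.inv₀ (by fun_prop) hne)))
    have h1 : HasDerivAt (fun x : ℝ => u * ((x : ℂ) + y * I - p)) (u * 1) x :=
      (((Complex.ofRealCLM.hasDerivAt (x := x)).add_const _).sub_const _).const_mul u
    refine (h1.clog_real (Or.inl (h x))).congr_deriv ?_
    have := hne x
    field_simp
  have vert : ∀ (u : ℂ) (x : ℝ), u ≠ 0 → (∀ y : ℝ, 0 < (u * (x + y * I - p)).re) →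
      I * (∫ y : ℝ in y₀..y₁, ((x : ℂ) + y * I - p)⁻¹) =
        Complex.log (u * (x + y₁ * I - p)) - Complex.log (u * (x + y₀ * I - p)) := by
    intro u x hu h
    have hne (y : ℝ) : (x : ℂ) + y * I - p ≠ 0 := fun h0 => by simpa [h0] using h y
    rw [← intervalIntegral.integral_const_mul]
    refine intervalIntegral.integral_eq_sub_of_hasDerivAt
      (f := fun y : ℝ => Complex.log (u * (x + y * I - p))) (fun y _ => ?_)
      (ContinuousOn.intervalIntegrable (Continuous.continuousOn
        (continuous_const.mul (Continuous.inv₀ (by fun_prop) hne))))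
    have h1 : HasDerivAt (fun y : ℝ => u * ((x : ℂ) + y * I - p)) (u * (1 * I)) y :=
      ((((Complex.ofRealCLM.hasDerivAt (x := y)).mul_const I).const_add _).sub_const _).const_mul u
    refine (h1.clog_real (Or.inl (h y))).congr_deriv ?_
    have := hne y
    field_simp
  have turn : ∀ z : ℂ, 0 < z.re → 0 < (I * z).re →
      Complex.log (I * z) = Complex.log z + π / 2 * I := by
    intro z hz hz'
    have hz0 : z ≠ 0 := fun h => by simp [h] at hz
    have h := Complex.abs_arg_lt_pi_div_two_iff.2 (Or.inl hz)
    rw [abs_lt] at h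
    rw [(Complex.log_mul_eq_add_log_iff Complex.I_ne_zero hz0).2, Complex.log_I]
    · ring
    · rw [Complex.arg_I]
      constructor <;> linarith [pi_pos]
  rw [horiz I y₀ Complex.I_ne_zero (by intro x; simp; linarith),
    horiz (-I) y₁ (by simp) (by intro x; simp; linarith),
    vert 1 x₁ one_ne_zero (by intro x; simp; linarith),
    vert (-1) x₀ (by simp) (by intro x; simp; linarith)]
  have e1 := turn (1 * (x₁ + y₀ * I - p)) (by simp; linarith) (by simp; linarith)
  have e2 := turn (-I * (x₁ + y₁ * I - p)) (by simp; linarith) (by simp; linarith)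
  have e3 := turn (-1 * (x₀ + y₁ * I - p)) (by simp; linarith) (by simp; linarith)
  have e4 := turn (I * (x₀ + y₀ * I - p)) (by simp; linarith) (by simp; linarith)
  rw [← mul_assoc] at e1 e2 e3 e4
  rw [mul_one] at e1
  rw [show I * -I = 1 by simp] at e2
  rw [show I * -1 = -I by ring] at e3
  rw [Complex.I_mul_I] at e4
  rw [e1, e2, e3, e4]
  ring

/-- Moving a horizontal line of integration across a simple pole. -/
theorem integral_horizontal_sub_of_simple_pole {f H : ℂ → ℂ} {p : ℂ} {S : Set ℂ} {y₀ y₁ C R : ℝ}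
    (hS : IsOpen S) (hH : DifferentiableOn ℂ H S) (hy₀ : y₀ < p.im) (hy₁ : p.im < y₁)
    (hsub : ∀ z : ℂ, z.im ∈ Icc y₀ y₁ → z ∈ S)
    (hf : ∀ z : ℂ, z.im ∈ Icc y₀ y₁ → z ≠ p → f z = H z / (z - p))
    (hbd : ∀ x y : ℝ, R ≤ |x| → y ∈ Icc y₀ y₁ → ‖f (x + y * I)‖ ≤ C * rexp (-x ^ 2)) :
    (∫ x : ℝ, f (x + y₀ * I)) - (∫ x : ℝ, f (x + y₁ * I)) = 2 * π * I * H p := by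
  have hy : y₀ ≤ y₁ := (hy₀.trans hy₁).le
  have hpS : S ∈ 𝓝 p := hS.mem_nhds (hsub p ⟨hy₀.le, hy₁.le⟩)
  have hg : DifferentiableOn ℂ (dslope H p) S := (Complex.differentiableOn_dslope hpS).2 hH
  have hfg (z : ℂ) (hz : z.im ∈ Icc y₀ y₁) (hzp : z ≠ p) :
      f z = H p * (z - p)⁻¹ + dslope H p z := by
    have : z - p ≠ 0 := sub_ne_zero.2 hzp
    rw [hf z hz hzp, dslope_of_ne _ hzp, slope_def_field]
    field_simp
    ring
  have side (γ : ℝ → ℂ) (t₀ t₁ : ℝ) (hγ : Continuous γ)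
      (h : ∀ t ∈ uIcc t₀ t₁, (γ t).im ∈ Icc y₀ y₁ ∧ γ t ≠ p) :
      (∫ t in t₀..t₁, f (γ t)) =
        H p * (∫ t in t₀..t₁, (γ t - p)⁻¹) + ∫ t in t₀..t₁, dslope H p (γ t) := by
    rw [← intervalIntegral.integral_const_mul, ← intervalIntegral.integral_add]
    · exact intervalIntegral.integral_congr fun t ht => hfg _ (h t ht).1 (h t ht).2
    · refine ContinuousOn.intervalIntegrable (continuousOn_const.mul (ContinuousOn.inv₀ ?_ ?_))
      · fun_prop
      · exact fun t ht => sub_ne_zero.2 (h t ht).2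
    · exact ContinuousOn.intervalIntegrable
        (hg.continuousOn.comp hγ.continuousOn fun t ht => hsub _ (h t ht).1)
  have rect (X : ℝ) (hX : |p.re| < X) :
      (∫ x : ℝ in -X..X, f (x + y₀ * I)) - (∫ x : ℝ in -X..X, f (x + y₁ * I)) +
        I * (∫ y : ℝ in y₀..y₁, f ((X : ℝ) + y * I)) -
        I * (∫ y : ℝ in y₀..y₁, f ((-X : ℝ) + y * I)) = 2 * π * I * H p := by
    obtain ⟨hX₀, hX₁⟩ := abs_lt.1 hX
    have h := Complex.integral_boundary_rect_eq_zero_of_differentiableOn (dslope H p)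
      ⟨-X, y₀⟩ ⟨X, y₁⟩ (hg.mono fun z hz => hsub z (by
        have := hz.2
        simpa [uIcc_of_le hy] using this))
    have h' := integral_boundary_rect_inv_sub hX₀ hX₁ hy₀ hy₁
    simp only [smul_eq_mul] at h
    rw [side (fun x => x + y₀ * I) _ _ (by fun_prop), side (fun x => x + y₁ * I) _ _ (by fun_prop),
      side (fun y => (X : ℝ) + y * I) _ _ (by fun_prop),
      side (fun y => (-X : ℝ) + y * I) _ _ (by fun_prop)]
    · linear_combination h + H p * h'
    · intro y h
      rw [uIcc_of_le hy] at h
      refine ⟨by simpa using h, fun e => ?_⟩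
      have := congrArg Complex.re e
      simp at this
      linarith
    · intro y h
      rw [uIcc_of_le hy] at h
      refine ⟨by simpa using h, fun e => ?_⟩
      have := congrArg Complex.re e
      simp at this
      linarith
    · intro x _
      refine ⟨by simpa using hy, fun e => ?_⟩
      have := congrArg Complex.im e
      simp at this
      linarith
    · intro x _
      refine ⟨by simpa using hy, fun e => ?_⟩
      have := congrArg Complex.im e
      simp at this
      linarith
  have hint (y : ℝ) (hyI : y ∈ Icc y₀ y₁) (hyp : y ≠ p.im) :
      Integrable fun x : ℝ => f (x + y * I) := by
    have hne (x : ℝ) : (x : ℂ) + y * I ≠ p := fun e => hyp (by simpa using congrArg Complex.im e)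
    have hmem (x : ℝ) : ((x : ℂ) + y * I).im ∈ Icc y₀ y₁ := by simpa using hyI
    have hcont : Continuous fun x : ℝ => f (x + y * I) := by
      have : (fun x : ℝ => f (x + y * I)) = fun x : ℝ => H (x + y * I) / (x + y * I - p) :=
        funext fun x => hf _ (hmem x) (hne x)
      rw [this]
      refine Continuous.div ?_ (by fun_prop) fun x => sub_ne_zero.2 (hne x)
      exact hH.continuousOn.comp_continuous (by fun_prop) fun x => hsub _ (hmem x)
    have hgauss : Integrable fun x : ℝ => rexp (-x ^ 2) := by
      simpa using integrable_exp_neg_mul_sq one_pos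
    refine hcont.locallyIntegrable.integrable_of_isBigO_cocompact (g := fun x : ℝ => rexp (-x ^ 2))
      (Asymptotics.IsBigO.of_bound C ?_) (hgauss.integrableAtFilter _)
    filter_upwards [tendsto_norm_cocompact_atTop.eventually_ge_atTop R] with x hx
    rw [Real.norm_of_nonneg (exp_pos _).le]
    exact hbd x y hx hyI
  have hvert (σ : ℝ) (hσ : |σ| = 1) :
      Tendsto (fun X : ℝ => ∫ y : ℝ in y₀..y₁, f ((σ * X : ℝ) + y * I)) atTop (𝓝 0) := by
    have hlim : Tendsto (fun X : ℝ => C * rexp (-X ^ 2) * |y₁ - y₀|) atTop (𝓝 0) := by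
      have : Tendsto (fun X : ℝ => rexp (-X ^ 2)) atTop (𝓝 0) :=
        tendsto_exp_neg_atTop_nhds_zero.comp (tendsto_pow_atTop two_ne_zero)
      simpa using (this.const_mul C).mul_const |y₁ - y₀|
    refine squeeze_zero_norm' ?_ hlim
    filter_upwards [eventually_ge_atTop R] with X hX
    refine intervalIntegral.norm_integral_le_of_norm_le_const fun y hyI => ?_
    rw [uIoc_of_le hy] at hyI
    have hσ2 : (σ * X) ^ 2 = X ^ 2 := by rw [mul_pow, ← sq_abs σ, hσ]; ring
    rw [← hσ2]
    refine hbd _ y ?_ ⟨hyI.1.le, hyI.2⟩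
    rw [abs_mul, hσ, one_mul]
    exact hX.trans (le_abs_self X)
  have hhor (y : ℝ) (hyI : y ∈ Icc y₀ y₁) (hyp : y ≠ p.im) :
      Tendsto (fun X : ℝ => ∫ x : ℝ in -X..X, f (x + y * I)) atTop (𝓝 (∫ x : ℝ, f (x + y * I))) :=
    intervalIntegral_tendsto_integral (hint y hyI hyp) tendsto_neg_atTop_atBot tendsto_id
  have hlim := (((hhor y₀ (left_mem_Icc.2 hy) hy₀.ne).sub
    (hhor y₁ (right_mem_Icc.2 hy) hy₁.ne')).add ((hvert 1 (by simp)).const_mul I)).sub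
      ((hvert (-1) (by simp)).const_mul I)
  simp only [one_mul, neg_one_mul, mul_zero, add_zero, sub_zero] at hlim
  refine tendsto_nhds_unique hlim (tendsto_const_nhds.congr' ?_)
  filter_upwards [eventually_gt_atTop |p.re|] with X hX
  exact (rect X hX).symm

/-- The direction `e^{-iπ/4}` of the contours. -/
local notation "ω" => Complex.exp (-(I * (π : ℂ) / 4))

/-- The integrand of `lerchContourIntegral`, as a function of the complex variable. -/
noncomputable def lerchIntegrand (a lam : ℝ) (s w : ℂ) : ℂ :=
  Complex.exp (-(I * (π : ℂ) * w ^ 2) + 2 * (π : ℂ) * I * w * ((a : ℂ) + (lam : ℂ))) /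
      (Complex.exp (I * (π : ℂ) * w - 2 * (π : ℂ) * I * (a : ℂ)) -
        Complex.exp (-(I * (π : ℂ) * w))) * w ^ (-s)

theorem exp_neg_I_mul_pi_div_four : ω = (√2 / 2 : ℝ) - (√2 / 2 : ℝ) * I := by
  rw [show -(I * (π : ℂ) / 4) = ((-(π / 4) : ℝ) : ℂ) * I by push_cast; ring, Complex.exp_mul_I,
    ← Complex.ofReal_cos, ← Complex.ofReal_sin, Real.cos_neg, Real.sin_neg, cos_pi_div_four,
    sin_pi_div_four]
  push_cast
  ring

theorem exp_neg_I_mul_pi_div_four_sq : ω ^ 2 = -I := by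
  have h2 : ((√2 : ℝ) : ℂ) ^ 2 = 2 := by
    rw [← Complex.ofReal_pow, sq_sqrt (by norm_num)]; norm_num
  rw [exp_neg_I_mul_pi_div_four]
  push_cast
  linear_combination (-I / 2 + (1 + I ^ 2) / 4 : ℂ) * h2 + (1 / 2 : ℂ) * Complex.I_sq

theorem norm_exp_neg_I_mul_pi_div_four : ‖ω‖ = 1 := by
  simp [Complex.norm_exp]

theorem re_rotate (z : ℂ) : (ω * z).re = √2 / 2 * (z.re + z.im) := by
  rw [exp_neg_I_mul_pi_div_four]
  simp
  ring

theorem im_rotate (z : ℂ) : (ω * z).im = √2 / 2 * (z.im - z.re) := by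
  rw [exp_neg_I_mul_pi_div_four]
  simp
  ring

theorem norm_cpow_le_exp {w : ℂ} (hw : 1 ≤ ‖w‖) (s : ℂ) :
    ‖w ^ s‖ ≤ rexp (|s.re| * ‖w‖ + π * |s.im|) := by
  refine (Complex.norm_cpow_le w s).trans ?_
  rw [div_eq_mul_inv, ← Real.exp_neg, Real.exp_add]
  have h1 : ‖w‖ ^ s.re ≤ rexp (|s.re| * ‖w‖) := by
    calc ‖w‖ ^ s.re ≤ ‖w‖ ^ |s.re| := rpow_le_rpow_of_exponent_le hw (le_abs_self _)
      _ ≤ rexp ‖w‖ ^ |s.re| := by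
        refine rpow_le_rpow (norm_nonneg w) ?_ (abs_nonneg _)
        linarith [add_one_le_exp ‖w‖]
      _ = rexp (|s.re| * ‖w‖) := by rw [← Real.exp_mul, mul_comm]
  have h2 : -(w.arg * s.im) ≤ π * |s.im| := by
    refine (neg_le_abs _).trans ?_
    rw [abs_mul]
    exact mul_le_mul_of_nonneg_right (Complex.abs_arg_le_pi w) (abs_nonneg _)
  exact mul_le_mul h1 (Real.exp_le_exp.2 h2) (exp_pos _).le (exp_pos _).le

theorem one_le_norm_lerch_denominator (a : ℝ) {w : ℂ} (hw : 1 ≤ |w.im|) :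
    1 ≤ ‖Complex.exp (I * (π : ℂ) * w - 2 * (π : ℂ) * I * (a : ℂ)) -
        Complex.exp (-(I * (π : ℂ) * w))‖ := by
  refine le_trans ?_ (abs_norm_sub_norm_le _ _)
  rw [Complex.norm_exp, Complex.norm_exp]
  have h1 : (I * (π : ℂ) * w - 2 * (π : ℂ) * I * (a : ℂ)).re = -(π * w.im) := by simp
  have h2 : (-(I * (π : ℂ) * w)).re = π * w.im := by simp
  rw [h1, h2]
  have key (v : ℝ) (hv : 1 ≤ v) : 1 ≤ rexp (π * v) - rexp (-(π * v)) := by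
    have := add_one_le_exp (π * v)
    have : rexp (-(π * v)) ≤ 1 := exp_le_one_iff.2 (by nlinarith [pi_pos])
    nlinarith [pi_gt_three]
  rcases le_abs.1 hw with h | h
  · rw [abs_sub_comm]
    exact (key _ h).trans (le_abs_self _)
  · have := key _ h
    rw [mul_neg, neg_neg] at this
    exact this.trans (le_abs_self _)

/-- Gaussian decay of the rotated Lerch integrand on horizontal strips. -/
theorem norm_lerchIntegrand_rotate_le (a lam : ℝ) (s : ℂ) (Y : ℝ) :
    ∃ C R : ℝ, ∀ x y : ℝ, R ≤ |x| → y ∈ Icc 0 Y →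
      ‖lerchIntegrand a lam s (ω * (x + y * I))‖ ≤ C * rexp (-x ^ 2) := by
  set K : ℝ := 2 * π * |a + lam| + |s.re| with hK
  have hK0 : 0 ≤ K := by positivity
  refine ⟨rexp (π * Y ^ 2 + K * Y + K ^ 2 + π * |s.im|), Y + 2, fun x y hx hy => ?_⟩
  obtain ⟨hy0, hyY⟩ := hy
  set z : ℂ := x + y * I with hz
  have hzre : z.re = x := by simp [hz]
  have hzim : z.im = y := by simp [hz]
  have hnorm : ‖ω * z‖ = ‖z‖ := by rw [norm_mul, norm_exp_neg_I_mul_pi_div_four, one_mul]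
  have hxz : |x| ≤ ‖z‖ := hzre ▸ Complex.abs_re_le_norm z
  have hzx : ‖z‖ ≤ |x| + Y := by
    have := Complex.norm_le_abs_re_add_abs_im z
    rw [hzre, hzim, abs_of_nonneg hy0] at this
    linarith
  have him : 1 ≤ |(ω * z).im| := by
    rw [im_rotate, hzre, hzim, abs_mul, abs_of_pos (by positivity)]
    have h1 : 2 ≤ |y - x| := by
      have := abs_sub_abs_le_abs_sub x y
      rw [abs_of_nonneg hy0, abs_sub_comm] at this
      linarith
    have h2 : 1 ≤ √2 := one_le_sqrt.2 (by norm_num)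
    nlinarith
  have hnum : ‖Complex.exp (-(I * (π : ℂ) * (ω * z) ^ 2) +
      2 * (π : ℂ) * I * (ω * z) * ((a : ℂ) + (lam : ℂ)))‖ ≤
        rexp (-π * (x ^ 2 - y ^ 2) + 2 * π * |a + lam| * ‖z‖) := by
    rw [Complex.norm_exp, Real.exp_le_exp, Complex.add_re]
    have e1 : (-(I * (π : ℂ) * (ω * z) ^ 2)).re = -π * (x ^ 2 - y ^ 2) := by
      rw [mul_pow, exp_neg_I_mul_pi_div_four_sq,
        show -(I * (π : ℂ) * (-I * z ^ 2)) = ((-π : ℝ) : ℂ) * z ^ 2 by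
          push_cast; linear_combination (π : ℂ) * z ^ 2 * Complex.I_sq,
        Complex.re_ofReal_mul, sq z, Complex.mul_re, hzre, hzim]
      ring
    have e2 : (2 * (π : ℂ) * I * (ω * z) * ((a : ℂ) + (lam : ℂ))).re ≤
        2 * π * |a + lam| * ‖z‖ := by
      refine (Complex.re_le_norm _).trans_eq ?_
      rw [← Complex.ofReal_add, norm_mul, norm_mul, hnorm, Complex.norm_real, norm_eq_abs]
      simp [abs_of_pos pi_pos]
      ring
    linarith
  have hcpow := norm_cpow_le_exp (w := ω * z) (s := -s) (by rw [hnorm]; linarith)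
  rw [hnorm, Complex.neg_re, Complex.neg_im, abs_neg, abs_neg] at hcpow
  rw [lerchIntegrand, norm_mul, norm_div]
  calc _ ≤ rexp (-π * (x ^ 2 - y ^ 2) + 2 * π * |a + lam| * ‖z‖) *
        rexp (|s.re| * ‖z‖ + π * |s.im|) := by
        gcongr
        exact (div_le_self (norm_nonneg _) (one_le_norm_lerch_denominator a him)).trans hnum
    _ ≤ _ := by
        rw [← Real.exp_add, ← Real.exp_add, Real.exp_le_exp]
        have h1 : K * ‖z‖ ≤ K * (|x| + Y) := mul_le_mul_of_nonneg_left hzx hK0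
        have h2 : K * |x| ≤ x ^ 2 + K ^ 2 := by
          nlinarith [sq_nonneg (K - |x|), sq_abs x, sq_nonneg x, sq_nonneg K]
        have h3 : π * y ^ 2 ≤ π * Y ^ 2 := by gcongr
        have h4 : 2 * x ^ 2 ≤ π * x ^ 2 := by nlinarith [pi_gt_three, sq_nonneg x]
        rw [hK] at h1 h2 ⊢
        linarith

theorem lerchContourIntegral_eq_integral_horizontal (a lam : ℝ) (s : ℂ) (c : ℝ) :
    lerchContourIntegral a lam s c =
      ω * ∫ x : ℝ, lerchIntegrand a lam s (ω * (x + ((√2 / 2 * c : ℝ) : ℂ) * I)) := by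
  rw [← integral_add_right_eq_self _ (√2 / 2 * c)]
  have h (ξ : ℝ) : ω * (((ξ + √2 / 2 * c : ℝ) : ℂ) + ((√2 / 2 * c : ℝ) : ℂ) * I) = c + ω * ξ := by
    have h1 : ω * ((√2 / 2 : ℝ) + (√2 / 2 : ℝ) * I) = 1 := by
      have h2 : ((√2 : ℝ) : ℂ) ^ 2 = 2 := by
        rw [← Complex.ofReal_pow, sq_sqrt (by norm_num)]; norm_num
      rw [exp_neg_I_mul_pi_div_four]
      push_cast
      linear_combination (1 / 2 : ℂ) * h2 - ((√2 : ℝ) : ℂ) ^ 2 / 4 * Complex.I_sq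
    push_cast at h1 ⊢
    linear_combination (c : ℂ) * h1
  simp only [h]
  rfl

theorem lerch_denominator_eq_zero_iff (a : ℝ) (w : ℂ) :
    Complex.exp (I * (π : ℂ) * w - 2 * (π : ℂ) * I * (a : ℂ)) -
        Complex.exp (-(I * (π : ℂ) * w)) = 0 ↔ ∃ m : ℤ, w = a + m := by
  rw [sub_eq_zero, Complex.exp_eq_exp_iff_exists_int]
  have hpi : 2 * (π : ℂ) * I ≠ 0 := Complex.two_pi_I_ne_zero
  refine exists_congr fun m => ⟨fun h => mul_left_cancel₀ hpi ?_, fun h => ?_⟩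
  · linear_combination h
  · rw [h]; ring

theorem rotate_mem_slitPlane {z : ℂ} (hz : 0 < z.im) : ω * z ∈ Complex.slitPlane := by
  rw [Complex.mem_slitPlane_iff, re_rotate, im_rotate]
  by_contra! h
  have h2 : 0 < √2 / 2 := by positivity
  have : z.im - z.re = 0 := (mul_eq_zero.1 h.2).resolve_left h2.ne'
  nlinarith

/-- Displacing the contour across the single pole `a + k`. -/
theorem lerchContourIntegral_sub_of_one_pole (a lam : ℝ) (s : ℂ) (k : ℕ) {c c' : ℝ} (hc0 : 0 < c)
    (hc : c ∈ Ioo (a + k - 1) (a + k)) (hc' : c' ∈ Ioo (a + k) (a + k + 1)) :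
    Complex.exp (-(I * (π : ℂ) * (a : ℂ) * (1 + (a : ℂ) + 2 * (lam : ℂ)))) *
        (lerchContourIntegral a lam s c - lerchContourIntegral a lam s c') =
      Complex.exp (2 * (π : ℂ) * I * (lam : ℂ) * (k : ℂ)) * ((a : ℂ) + (k : ℂ)) ^ (-s) := by
  have hr : 0 < √2 / 2 := by positivity
  have hω : ω ≠ 0 := Complex.exp_ne_zero _
  obtain ⟨p, hp⟩ : ∃ p : ℂ, ω * p = a + k := ⟨(a + k) / ω, mul_div_cancel₀ _ hω⟩
  have him (z : ℂ) (m : ℤ) (h : ω * z = a + m) : z.im = √2 / 2 * (a + m) := by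
    have h1 : √2 / 2 * (z.re + z.im) = a + m := by rw [← re_rotate, h]; simp
    have h2 : √2 / 2 * (z.im - z.re) = 0 := by rw [← im_rotate, h]; simp
    have h3 : z.im = z.re := by
      linarith [(mul_eq_zero.1 h2).resolve_left hr.ne']
    have h4 : √2 ^ 2 = 2 := sq_sqrt (by norm_num)
    rw [← h1, ← h3]
    linear_combination (-z.im / 2) * h4
  have hpim : p.im = √2 / 2 * (a + k) := by simpa using him p k (by simpa using hp)
  set N : ℂ → ℂ := fun z =>
    Complex.exp (-(I * (π : ℂ) * (ω * z) ^ 2) + 2 * (π : ℂ) * I * (ω * z) * ((a : ℂ) + (lam : ℂ))) *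
      (ω * z) ^ (-s) with hN
  set D : ℂ → ℂ := fun z => Complex.exp (I * (π : ℂ) * (ω * z) - 2 * (π : ℂ) * I * (a : ℂ)) -
    Complex.exp (-(I * (π : ℂ) * (ω * z))) with hD
  set S : Set ℂ := {z | 0 < z.im} ∩
    ({z | √2 / 2 * (a + k - 1) < z.im} ∩ {z | z.im < √2 / 2 * (a + k + 1)})
  have hS : IsOpen S := (isOpen_lt continuous_const Complex.continuous_im).inter
    ((isOpen_lt continuous_const Complex.continuous_im).inter
      (isOpen_lt Complex.continuous_im continuous_const))
  have hDdiff : Differentiable ℂ D := by fun_prop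
  have hDp : D p = 0 := (lerch_denominator_eq_zero_iff a _).2 ⟨k, by simpa using hp⟩
  have hDmul (z : ℂ) : D z = (z - p) * dslope D p z := by
    simpa [hDp] using (sub_smul_dslope D p z).symm
  have hexp : Complex.exp (I * (π : ℂ) * (ω * p) - 2 * (π : ℂ) * I * (a : ℂ)) =
      Complex.exp (-(I * (π : ℂ) * (ω * p))) := sub_eq_zero.1 hDp
  have hderiv : dslope D p p = 2 * π * I * ω * Complex.exp (-(I * (π : ℂ) * (ω * p))) := by
    rw [dslope_same]
    have h0 : HasDerivAt (fun z => I * (π : ℂ) * (ω * z)) (I * (π : ℂ) * (ω * 1)) p :=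
      ((hasDerivAt_id p).const_mul _).const_mul _
    refine ((h0.sub_const (2 * (π : ℂ) * I * (a : ℂ))).cexp.sub h0.neg.cexp).deriv.trans ?_
    rw [hexp]
    simp only [Pi.neg_apply]
    ring
  have hq (z : ℂ) (hz : z ∈ S) : dslope D p z ≠ 0 := by
    intro h
    have hDz : D z = 0 := by rw [hDmul, h, mul_zero]
    obtain ⟨m, hm⟩ := (lerch_denominator_eq_zero_iff a _).1 hDz
    have hzim := him z m hm
    obtain ⟨-, h1, h2⟩ := hz
    rw [mem_ofPred_eq, hzim] at h1 h2
    have h1 := lt_of_mul_lt_mul_left h1 hr.le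
    have h2 := lt_of_mul_lt_mul_left h2 hr.le
    have hmk : m = k := by
      have h3 : (k : ℝ) < m + 1 := by linarith
      have h4 : (m : ℝ) < k + 1 := by linarith
      norm_cast at h3 h4
      omega
    have hzp : z = p := mul_left_cancel₀ hω (by rw [hm, hp, hmk]; simp)
    rw [hzp, hderiv] at h
    exact mul_ne_zero (mul_ne_zero Complex.two_pi_I_ne_zero hω) (Complex.exp_ne_zero _) h
  have hH : DifferentiableOn ℂ (fun z => N z / dslope D p z) S := by
    refine DifferentiableOn.div ?_ ?_ hq
    · refine DifferentiableOn.mul (by fun_prop) ?_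
      refine DifferentiableOn.cpow_const (by fun_prop) fun z hz => rotate_mem_slitPlane hz.1
    · have : Differentiable ℂ (dslope D p) := by
        rw [← differentiableOn_univ, Complex.differentiableOn_dslope univ_mem]
        exact hDdiff.differentiableOn
      exact this.differentiableOn
  obtain ⟨C, R, hCR⟩ := norm_lerchIntegrand_rotate_le a lam s (√2 / 2 * c')
  have hmain := integral_horizontal_sub_of_simple_pole (y₀ := √2 / 2 * c) (y₁ := √2 / 2 * c')
    (f := fun z => lerchIntegrand a lam s (ω * z)) (R := R) (C := C) hS hH
    (by rw [hpim]; exact mul_lt_mul_of_pos_left hc.2 hr)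
    (by rw [hpim]; exact mul_lt_mul_of_pos_left hc'.1 hr)
    (fun z hz => ⟨(mul_pos hr hc0).trans_le hz.1,
      (mul_lt_mul_of_pos_left hc.1 hr).trans_le hz.1,
      hz.2.trans_lt (mul_lt_mul_of_pos_left hc'.2 hr)⟩)
    (fun z _ _ => by
      have : lerchIntegrand a lam s (ω * z) = N z / D z := by
        simp only [lerchIntegrand, hN, hD]
        ring
      rw [this, hDmul, div_div, mul_comm (z - p)])
    (fun x y hx hy => hCR x y hx ⟨(mul_pos hr hc0).le.trans hy.1, hy.2⟩)
  have hpar : Complex.exp (I * (π : ℂ) * ((k : ℂ) - k ^ 2)) = 1 := by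
    obtain ⟨m, hm⟩ := (Int.even_mul_pred_self (k : ℤ)).neg
    rw [Complex.exp_eq_one_iff]
    refine ⟨m, ?_⟩
    have : (-((k : ℂ) * (k - 1))) = m + m := by exact_mod_cast hm
    linear_combination I * (π : ℂ) * this
  have hres : ω * (2 * π * I * (N p / dslope D p p)) =
      N p * Complex.exp (I * (π : ℂ) * (ω * p)) := by
    rw [hderiv, Complex.exp_neg (I * (π : ℂ) * (ω * p))]
    have h1 := Complex.two_pi_I_ne_zero
    have h2 := Complex.exp_ne_zero (I * (π : ℂ) * (ω * p))
    generalize Complex.exp (I * (π : ℂ) * (ω * p)) = E at *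
    generalize ω = u at *
    field_simp
  rw [lerchContourIntegral_eq_integral_horizontal, lerchContourIntegral_eq_integral_horizontal,
    ← mul_sub, hmain, hres]
  simp only [hN, hp]
  rw [mul_right_comm (Complex.exp (-(I * (π : ℂ) * ((a : ℂ) + k) ^ 2) + _)), ← Complex.exp_add,
    ← mul_assoc, ← Complex.exp_add]
  congr 1
  refine Eq.trans ?_ (mul_eq_left₀ (Complex.exp_ne_zero _) |>.2 hpar)
  rw [← Complex.exp_add]
  congr 1
  ring

/-- **Displacing the contour across the poles `a, a+1, …, a+n-1`** produces exactly the
first `n` terms of the Lerch series: for `0 < c₁ < a` and `a + n - 1 < c₂ < a + n`,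
`e^{-iπa(1+a+2λ)} (L(c₁) - L(c₂)) = Σ_{k=0}^{n-1} e^{2πiλk}(a+k)^{-s}`. -/
theorem lerch_contour_displacement (a lam : ℝ) (ha : a ∈ Ioc (0:ℝ) 1)
    (hlam : lam ∈ Ioo (0:ℝ) 1) (s : ℂ) (n : ℕ) (hn : 1 ≤ n) (c₁ c₂ : ℝ)
    (hc₁ : c₁ ∈ Ioo 0 a) (hc₂ : c₂ ∈ Ioo (a + n - 1) (a + n)) :
    Complex.exp (-(I * (π : ℂ) * (a : ℂ) * (1 + (a : ℂ) + 2 * (lam : ℂ)))) *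
        (lerchContourIntegral a lam s c₁ - lerchContourIntegral a lam s c₂)
      = ∑ k ∈ Finset.range n,
          Complex.exp (2 * (π : ℂ) * I * (lam : ℂ) * (k : ℂ)) * ((a : ℂ) + (k : ℂ)) ^ (-s) := by
  induction n, hn using Nat.le_induction generalizing c₂ with
  | base =>
    simp only [Nat.cast_one, mem_Ioo] at hc₂
    rw [Finset.sum_range_one]
    exact lerchContourIntegral_sub_of_one_pole a lam s 0 hc₁.1
      (by constructor <;> push_cast <;> linarith [hc₁.1, hc₁.2, ha.2])
      (by constructor <;> push_cast <;> linarith [hc₂.1, hc₂.2])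
  | succ n hn ih =>
    simp only [Nat.cast_add, Nat.cast_one, mem_Ioo] at hc₂
    have hn' : (1 : ℝ) ≤ n := by exact_mod_cast hn
    have h := lerchContourIntegral_sub_of_one_pole a lam s n (c := a + n - 1 / 2) (c' := c₂)
      (by linarith [ha.1]) (by constructor <;> linarith)
      (by constructor <;> linarith [hc₂.1, hc₂.2])
    rw [Finset.sum_range_succ, ← h, ← ih (a + n - 1 / 2) (by constructor <;> linarith)]
    ring
end

section
/- Let s ∈ ℂ with s ≠ 1 and s not an odd positive integer, and let c₁, c₂ ∈ (0,1). Then the Riemann zeta function satisfies the Riemann–Siegel integral formula ζ(s) = −e^{iπ/4} ∫_{-∞}^{∞} e^{iπ w₁(t)²} w₁(t)^{-s} / (e^{iπ w₁(t)} − e^{-iπ w₁(t)}) dt + π^{s−1/2} (Γ((1−s)/2)/Γ(s/2)) · e^{-iπ/4} ∫_{-∞}^{∞} e^{-iπ w₂(t)²} w₂(t)^{s−1} / (e^{iπ w₂(t)} − e^{-iπ w₂(t)}) dt, where w₁(t) = c₁ + e^{iπ/4} t and w₂(t) = c₂ + e^{-iπ/4} t, and all complex powers are principal. -/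
open Real Set
open Complex (I)

/-- The point `w₁(t) = c₁ + e^{iπ/4} t` on the line crossing the real axis at `c₁`
with direction `e^{iπ/4}`. -/
noncomputable def rsLineUp (c t : ℝ) : ℂ :=
  (c : ℂ) + Complex.exp (I * (π : ℂ) / 4) * (t : ℂ)

/-- The point `w₂(t) = c₂ + e^{-iπ/4} t` on the line crossing the real axis at `c₂`
with direction `e^{-iπ/4}`. -/
noncomputable def rsLineDown (c t : ℝ) : ℂ :=
  (c : ℂ) + Complex.exp (-(I * (π : ℂ) / 4)) * (t : ℂ)

section

open MeasureTheory Filter Topology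

lemma integrable_exp_neg_abs : Integrable (fun t : ℝ => Real.exp (-|t|)) := by
  refine LocallyIntegrable.integrable_of_isBigO_atTop_of_norm_isNegInvariant
    (g := fun t : ℝ => Real.exp (-t)) ?_ ?_ ?_ ?_
  · exact (by fun_prop : Continuous fun t : ℝ => Real.exp (-|t|)).locallyIntegrable
  · exact Eventually.of_forall fun t => by simp
  · refine EventuallyEq.isBigO ?_
    filter_upwards [eventually_ge_atTop (0 : ℝ)] with t ht
    rw [abs_of_nonneg ht]
  · exact ⟨Ioi 0, Ioi_mem_atTop 0, by simpa using exp_neg_integrableOn_Ioi 0 one_pos⟩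

lemma integrable_of_norm_le_exp_neg_abs {E : Type*} [NormedAddCommGroup E] {h : ℝ → E} {K : ℝ}
    (hc : Continuous h) (hb : ∀ t : ℝ, 1 ≤ |t| → ‖h t‖ ≤ K * Real.exp (-|t|)) :
    Integrable h := by
  obtain ⟨M, hM⟩ := (isCompact_Icc (a := (-1 : ℝ)) (b := 1)).exists_bound_of_continuousOn
    hc.continuousOn
  refine Integrable.mono' (integrable_exp_neg_abs.const_mul (|K| + |M| * Real.exp 1))
    hc.aestronglyMeasurable (Eventually.of_forall fun t => ?_)
  have h0 := Real.exp_pos (-|t|)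
  rcases le_total 1 |t| with ht | ht
  · refine (hb t ht).trans (mul_le_mul_of_nonneg_right ?_ h0.le)
    have : 0 ≤ |M| * Real.exp 1 := by positivity
    linarith [le_abs_self K]
  · have h1 : ‖h t‖ ≤ |M| := (hM t (by rwa [mem_Icc, ← abs_le])).trans (le_abs_self M)
    have h2 : 1 ≤ Real.exp 1 * Real.exp (-|t|) := by
      rw [← Real.exp_add]
      exact Real.one_le_exp (by linarith)
    have h3 : 0 ≤ |K| * Real.exp (-|t|) := by positivity
    nlinarith [abs_nonneg M]

/-- Cauchy's theorem for the strip between two parallel lines, for a function that decays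
exponentially along the strip. -/
theorem integral_parallel_lines_eq {e : ℂ} (he : ‖e‖ = 1) {a b : ℝ} (hab : a ≤ b) {F : ℂ → ℂ}
    {S : Set ℂ} (hS : S.Countable) {K : ℝ}
    (hc : ∀ c ∈ Icc a b, ∀ t : ℝ, ContinuousAt F (c + e * t))
    (hd : ∀ c ∈ Icc a b, ∀ t : ℝ, (c + e * t : ℂ) ∉ S → DifferentiableAt ℂ F (c + e * t))
    (hb : ∀ c ∈ Icc a b, ∀ t : ℝ, 1 ≤ |t| → ‖F (c + e * t)‖ ≤ K * Real.exp (-|t|)) :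
    ∫ t : ℝ, F (a + e * t) = ∫ t : ℝ, F (b + e * t) := by
  have he0 : e ≠ 0 := by rintro rfl; simp at he
  have hre : |e.re| ≤ 1 := he ▸ Complex.abs_re_le_norm e
  have hnorm : (e.re : ℂ) ^ 2 + (e.im : ℂ) ^ 2 = 1 := by
    have h := Complex.sq_norm e
    rw [he, Complex.normSq_apply] at h
    exact_mod_cast (by linarith : e.re ^ 2 + e.im ^ 2 = 1)
  have hpt : ∀ c x : ℝ, e * ((x : ℂ) + ((-(c * e.im) : ℝ) : ℂ) * I)
      = c + e * ((x - c * e.re : ℝ) : ℂ) := by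
    intro c x
    have h1 : e * ((e.re : ℂ) - e.im * I) = 1 := by
      nth_rewrite 1 [← Complex.re_add_im e]
      linear_combination hnorm - (e.im : ℂ) ^ 2 * Complex.I_sq
    push_cast
    linear_combination (c : ℂ) * h1
  set f : ℂ → ℂ := fun z => F (e * z) with hf
  have hmem : ∀ y ∈ uIcc (-(a * e.im)) (-(b * e.im)), ∃ c ∈ Icc a b, y = -(c * e.im) := by
    intro y hy
    have : y ∈ (fun x => x * (-e.im)) '' uIcc a b := by
      rw [image_mul_const_uIcc]
      simpa using hy
    obtain ⟨c, hc, rfl⟩ := this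
    exact ⟨c, by rwa [uIcc_of_le hab] at hc, by simp⟩
  have hline : ∀ c ∈ Icc a b, Integrable (fun t : ℝ => F (c + e * t)) := fun c hcm =>
    integrable_of_norm_le_exp_neg_abs
      (continuous_iff_continuousAt.2 fun t => (hc c hcm t).comp (f := fun t : ℝ => (c + e * t : ℂ))
        (by fun_prop)) (hb c hcm)
  have hlim : ∀ c ∈ Icc a b, Tendsto (fun T : ℝ => ∫ x in -T..T,
      f (x + ((-(c * e.im) : ℝ) : ℂ) * I)) atTop (𝓝 (∫ t : ℝ, F (c + e * t))) := by
    intro c hcm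
    have h1 : (fun x : ℝ => f (x + ((-(c * e.im) : ℝ) : ℂ) * I))
        = fun x : ℝ => F (c + e * ((x - c * e.re : ℝ) : ℂ)) := by
      funext x
      rw [hf]
      exact congrArg F (hpt c x)
    have h2 := integral_sub_right_eq_self (μ := volume) (fun t : ℝ => F (c + e * t)) (c * e.re)
    rw [h1, ← h2]
    exact intervalIntegral_tendsto_integral ((hline c hcm).comp_sub_right (c * e.re))
      tendsto_neg_atTop_atBot tendsto_id
  set M : ℝ := max |a| |b| with hM
  have hcM : ∀ c ∈ Icc a b, |c| ≤ M := fun c hcm => abs_le_max_abs_abs hcm.1 hcm.2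
  have hside : ∀ σ : ℝ, |σ| = 1 → Tendsto (fun T : ℝ => ∫ y in (-(a * e.im))..(-(b * e.im)),
      f (((σ * T : ℝ) : ℂ) + y * I)) atTop (𝓝 0) := by
    intro σ hσ
    rw [tendsto_zero_iff_norm_tendsto_zero]
    have hz : Tendsto (fun T : ℝ => |K| * Real.exp (M - T) * |-(b * e.im) - -(a * e.im)|)
        atTop (𝓝 0) := by
      have h := (Real.tendsto_exp_atBot.comp (tendsto_const_nhds.add_atBot tendsto_neg_atTop_atBot :
        Tendsto (fun T : ℝ => M + -T) atTop atBot))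
      simpa [Function.comp_def, sub_eq_add_neg] using (h.const_mul |K|).mul_const _
    refine squeeze_zero' (Eventually.of_forall fun T => norm_nonneg _) ?_ hz
    filter_upwards [eventually_ge_atTop (1 + M)] with T hT
    refine intervalIntegral.norm_integral_le_of_norm_le_const fun y hy => ?_
    obtain ⟨c, hcm, rfl⟩ := hmem y (uIoc_subset_uIcc hy)
    have h1 : f (((σ * T : ℝ) : ℂ) + ((-(c * e.im) : ℝ) : ℂ) * I)
        = F (c + e * ((σ * T - c * e.re : ℝ) : ℂ)) := congrArg F (hpt c (σ * T))
    have hT0 : 0 ≤ T := by linarith [(abs_nonneg a).trans (le_max_left |a| |b|)]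
    have h2 : T - M ≤ |σ * T - c * e.re| := by
      have h3 := abs_sub_abs_le_abs_sub (σ * T) (c * e.re)
      rw [abs_mul, abs_mul, hσ, abs_of_nonneg hT0, one_mul] at h3
      have h4 : |c| * |e.re| ≤ M :=
        (mul_le_of_le_one_right (abs_nonneg c) hre).trans (hcM c hcm)
      linarith
    rw [h1]
    refine (hb c hcm _ (by linarith)).trans ?_
    gcongr
    · exact le_abs_self K
    · linarith
  have hzero : ∀ T : ℝ, (((∫ x in -T..T, f (x + ((-(a * e.im) : ℝ) : ℂ) * I))
      - ∫ x in -T..T, f (x + ((-(b * e.im) : ℝ) : ℂ) * I))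
      + I • ∫ y in (-(a * e.im))..(-(b * e.im)), f (((1 * T : ℝ) : ℂ) + y * I))
      - I • ∫ y in (-(a * e.im))..(-(b * e.im)), f (((-1 * T : ℝ) : ℂ) + y * I) = 0 := by
    intro T
    have h := Complex.integral_boundary_rect_eq_zero_of_differentiable_on_off_countable f
      ⟨-T, -(a * e.im)⟩ ⟨T, -(b * e.im)⟩ ((fun z => e * z) ⁻¹' S)
      (hS.preimage (mul_right_injective₀ he0)) ?_ ?_
    · simpa only [one_mul, neg_one_mul] using h
    · intro z hz
      obtain ⟨c, hcm, hy⟩ := hmem z.im hz.2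
      have hz' : e * z = c + e * ((z.re - c * e.re : ℝ) : ℂ) := by
        rw [← hpt, ← hy, Complex.re_add_im]
      refine ContinuousAt.continuousWithinAt ?_
      refine ContinuousAt.comp (f := fun z => e * z) (g := F) ?_ (by fun_prop)
      rw [hz']
      exact hc c hcm _
    · rintro z ⟨hz, hzS⟩
      obtain ⟨c, hcm, hy⟩ := hmem z.im (Ioo_subset_Icc_self hz.2)
      have hz' : e * z = c + e * ((z.re - c * e.re : ℝ) : ℂ) := by
        rw [← hpt, ← hy, Complex.re_add_im]
      refine DifferentiableAt.comp (f := fun z => e * z) (g := F) z ?_ (by fun_prop)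
      rw [hz']
      exact hd c hcm _ (by rw [← hz']; exact hzS)
  have hA := (((hlim a ⟨le_rfl, hab⟩).sub (hlim b ⟨hab, le_rfl⟩)).add
    ((hside 1 (by simp)).const_smul I)).sub ((hside (-1) (by simp)).const_smul I)
  have hB := tendsto_nhds_unique hA
    (tendsto_const_nhds.congr fun T => (hzero T).symm)
  simpa [sub_eq_zero] using hB

/-- A parameter integral `∫ g(t) exp(z L(t))` is complex differentiable in `z` wherever the
formal derivative is locally dominated. -/
theorem differentiableAt_integral_mul_exp {μ : Measure ℝ} {g L : ℝ → ℂ} {b : ℝ → ℝ} {z₀ : ℂ}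
    {ε : ℝ} (hε : 0 < ε) (hg : AEStronglyMeasurable g μ) (hL : AEStronglyMeasurable L μ)
    (hint : Integrable (fun t => g t * Complex.exp (z₀ * L t)) μ) (hbi : Integrable b μ)
    (hb : ∀ᵐ t ∂μ, ∀ z ∈ Metric.ball z₀ ε, ‖g t * (L t * Complex.exp (z * L t))‖ ≤ b t) :
    DifferentiableAt ℂ (fun z => ∫ t, g t * Complex.exp (z * L t) ∂μ) z₀ := by
  have hexp : ∀ z : ℂ, AEStronglyMeasurable (fun t => Complex.exp (z * L t)) μ := fun z =>
    Complex.continuous_exp.comp_aestronglyMeasurable (hL.const_mul z)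
  refine (hasDerivAt_integral_of_dominated_loc_of_deriv_le (Metric.ball_mem_nhds z₀ hε)
    (F := fun z t => g t * Complex.exp (z * L t))
    (F' := fun z t => g t * (L t * Complex.exp (z * L t))) (bound := b)
    (Eventually.of_forall fun z => hg.mul (hexp z)) hint (hg.mul (hL.mul (hexp z₀))) hb hbi
    (Eventually.of_forall fun t z _ => ?_)).2.differentiableAt
  have h := (((hasDerivAt_id z).mul_const (L t)).cexp).const_mul (g t)
  simpa [mul_comm] using h

/-- The function `2i sin(πw)`, written with exponentials. -/
noncomputable def expSubExpNeg (w : ℂ) : ℂ :=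
  Complex.exp (I * (π : ℂ) * w) - Complex.exp (-(I * (π : ℂ) * w))

lemma differentiable_expSubExpNeg : Differentiable ℂ expSubExpNeg := by
  unfold expSubExpNeg
  fun_prop

lemma continuous_expSubExpNeg : Continuous expSubExpNeg :=
  differentiable_expSubExpNeg.continuous

lemma expSubExpNeg_neg (w : ℂ) : expSubExpNeg (-w) = -expSubExpNeg w := by
  simp [expSubExpNeg]

lemma exp_I_mul_pi : Complex.exp (I * (π : ℂ)) = -1 := by
  rw [mul_comm, Complex.exp_pi_mul_I]

lemma expSubExpNeg_add_one (w : ℂ) : expSubExpNeg (w + 1) = -expSubExpNeg w := by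
  simp only [expSubExpNeg, mul_add, mul_one, neg_add, Complex.exp_add, Complex.exp_neg,
    exp_I_mul_pi]
  norm_num
  ring

lemma expSubExpNeg_eq_zero_iff {w : ℂ} : expSubExpNeg w = 0 ↔ ∃ n : ℤ, w = n := by
  have hpi : (π : ℂ) ≠ 0 := by exact_mod_cast Real.pi_ne_zero
  rw [expSubExpNeg, sub_eq_zero, Complex.exp_eq_exp_iff_exists_int]
  refine exists_congr fun n => ⟨fun h => ?_, fun h => ?_⟩
  · have h2 : (2 * I * (π : ℂ)) * (w - n) = 0 := by linear_combination h
    simpa [hpi, sub_eq_zero] using h2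
  · rw [h]; ring

lemma one_le_norm_expSubExpNeg {w : ℂ} (hw : 1 / 2 ≤ |w.im|) : 1 ≤ ‖expSubExpNeg w‖ := by
  have h1 : ‖Complex.exp (I * (π : ℂ) * w)‖ = Real.exp (-(π * w.im)) := by
    rw [Complex.norm_exp]; congr 1; simp
  have h2 : ‖Complex.exp (-(I * (π : ℂ) * w))‖ = Real.exp (π * w.im) := by
    rw [Complex.norm_exp]; congr 1; simp
  have h3 := abs_norm_sub_norm_le (Complex.exp (I * (π : ℂ) * w))
    (Complex.exp (-(I * (π : ℂ) * w)))
  rw [h1, h2] at h3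
  refine le_trans ?_ h3
  have key : ∀ x : ℝ, 1 / 2 ≤ x → 1 ≤ Real.exp (π * x) - Real.exp (-(π * x)) := by
    intro x hx
    have h4 : 1 ≤ π * x := by nlinarith [Real.pi_gt_three]
    have h5 := Real.add_one_le_exp (π * x)
    have h6 : Real.exp (-(π * x)) ≤ 1 := Real.exp_le_one_iff.2 (by linarith)
    linarith
  rcases le_abs.1 hw with h | h
  · rw [abs_sub_comm]
    exact (key _ h).trans (le_abs_self _)
  · have := key _ h
    rw [mul_neg, neg_neg] at this
    exact this.trans (le_abs_self _)

lemma exp_I_pi_div_four :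
    Complex.exp (I * (π : ℂ) / 4) = ((√2 / 2 : ℝ) : ℂ) + ((√2 / 2 : ℝ) : ℂ) * I := by
  rw [show I * (π : ℂ) / 4 = ((π / 4 : ℝ) : ℂ) * I by push_cast; ring, Complex.exp_mul_I,
    ← Complex.ofReal_cos, ← Complex.ofReal_sin, Real.cos_pi_div_four, Real.sin_pi_div_four]

lemma exp_neg_I_pi_div_four :
    Complex.exp (-(I * (π : ℂ) / 4)) = ((√2 / 2 : ℝ) : ℂ) - ((√2 / 2 : ℝ) : ℂ) * I := by
  rw [show -(I * (π : ℂ) / 4) = ((-(π / 4) : ℝ) : ℂ) * I by push_cast; ring, Complex.exp_mul_I,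
    ← Complex.ofReal_cos, ← Complex.ofReal_sin, Real.cos_neg, Real.sin_neg,
    Real.cos_pi_div_four, Real.sin_pi_div_four]
  push_cast
  ring

lemma norm_exp_I_pi_div_four : ‖Complex.exp (I * (π : ℂ) / 4)‖ = 1 := by
  rw [Complex.norm_exp]; simp

lemma norm_exp_neg_I_pi_div_four : ‖Complex.exp (-(I * (π : ℂ) / 4))‖ = 1 := by
  rw [Complex.norm_exp]; simp

lemma rsLineUp_re (c t : ℝ) : (rsLineUp c t).re = c + √2 / 2 * t := by
  rw [rsLineUp, exp_I_pi_div_four]; simp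

lemma rsLineUp_im (c t : ℝ) : (rsLineUp c t).im = √2 / 2 * t := by
  rw [rsLineUp, exp_I_pi_div_four]; simp

lemma rsLineDown_re (c t : ℝ) : (rsLineDown c t).re = c + √2 / 2 * t := by
  rw [rsLineDown, exp_neg_I_pi_div_four]; simp

lemma rsLineDown_im (c t : ℝ) : (rsLineDown c t).im = -(√2 / 2 * t) := by
  rw [rsLineDown, exp_neg_I_pi_div_four]; simp

lemma continuous_rsLineUp (c : ℝ) : Continuous (rsLineUp c) := by
  unfold rsLineUp
  fun_prop

lemma continuous_rsLineDown (c : ℝ) : Continuous (rsLineDown c) := by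
  unfold rsLineDown
  fun_prop

lemma abs_rsLineUp_im (c t : ℝ) : |(rsLineUp c t).im| = √2 / 2 * |t| := by
  rw [rsLineUp_im, abs_mul, abs_of_pos (by positivity)]

lemma abs_rsLineDown_im (c t : ℝ) : |(rsLineDown c t).im| = √2 / 2 * |t| := by
  rw [rsLineDown_im, abs_neg, abs_mul, abs_of_pos (by positivity)]

lemma half_le_sqrt_two_div_two_mul {x : ℝ} (hx : 1 ≤ x) : 1 / 2 ≤ √2 / 2 * x := by
  have : 1 ≤ √2 := Real.one_le_sqrt.2 (by norm_num)
  nlinarith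

lemma norm_rsLineUp_le (c t : ℝ) : ‖rsLineUp c t‖ ≤ |c| + |t| := by
  refine (norm_add_le _ _).trans ?_
  simp [norm_exp_I_pi_div_four]

lemma norm_rsLineDown_le (c t : ℝ) : ‖rsLineDown c t‖ ≤ |c| + |t| := by
  refine (norm_add_le _ _).trans ?_
  simp [norm_exp_neg_I_pi_div_four]

/-- The modulus of `e^{iπw²}` on the line `rsLineUp c`, and of `e^{-iπw²}` on `rsLineDown c`. -/
noncomputable def gaussWeight (c t : ℝ) : ℝ :=
  Real.exp (-(π * t ^ 2) - √2 * π * c * t)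

lemma norm_exp_sq_rsLineUp (c t : ℝ) :
    ‖Complex.exp (I * (π : ℂ) * (rsLineUp c t) ^ 2)‖ = gaussWeight c t := by
  have h2 : √2 * √2 = 2 := Real.mul_self_sqrt (by norm_num)
  rw [Complex.norm_exp, gaussWeight]
  congr 1
  simp only [pow_two, Complex.mul_re, Complex.mul_im, Complex.I_re, Complex.I_im,
    Complex.ofReal_re, Complex.ofReal_im, rsLineUp_re, rsLineUp_im]
  linear_combination (-(π * t ^ 2) / 2) * h2

lemma norm_exp_sq_rsLineDown (c t : ℝ) :
    ‖Complex.exp (-(I * (π : ℂ) * (rsLineDown c t) ^ 2))‖ = gaussWeight c t := by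
  have h2 : √2 * √2 = 2 := Real.mul_self_sqrt (by norm_num)
  rw [Complex.norm_exp, gaussWeight]
  congr 1
  simp only [pow_two, Complex.neg_re, Complex.mul_re, Complex.mul_im, Complex.I_re, Complex.I_im,
    Complex.ofReal_re, Complex.ofReal_im, rsLineDown_re, rsLineDown_im]
  linear_combination (-(π * t ^ 2) / 2) * h2

lemma gaussWeight_mul_exp_le {c : ℝ} (hc : |c| ≤ 2) (k t : ℝ) :
    gaussWeight c t * Real.exp (k * |t|) ≤ Real.exp ((k + 10) ^ 2) * Real.exp (-|t|) := by
  rw [gaussWeight, ← Real.exp_add, ← Real.exp_add, Real.exp_le_exp]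
  have h1 : -(√2 * π * c * t) ≤ 9 * |t| := by
    refine (neg_le_abs _).trans ?_
    rw [abs_mul, abs_mul, abs_of_pos (by positivity : 0 < √2 * π)]
    have h3 : √2 * π ≤ 9 / 2 := by
      have h4 : √2 ≤ 1.415 := Real.sqrt_le_iff.2 ⟨by norm_num, by norm_num⟩
      nlinarith [Real.pi_lt_d2, Real.pi_pos]
    gcongr
    nlinarith [abs_nonneg c, Real.pi_pos]
  have h5 : 3 * |t| ^ 2 ≤ π * t ^ 2 := by
    rw [sq_abs]
    nlinarith [Real.pi_gt_three, sq_nonneg t]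
  nlinarith [sq_nonneg (|t| - (k + 10) / 2), abs_nonneg t]

lemma norm_log_le {w : ℂ} (hw : w ≠ 0) : ‖Complex.log w‖ ≤ ‖w‖ + ‖w‖⁻¹ + π := by
  have hp : 0 < ‖w‖ := norm_pos_iff.2 hw
  refine (Complex.norm_le_abs_re_add_abs_im _).trans ?_
  rw [Complex.log_re, Complex.log_im]
  refine add_le_add ?_ (Complex.abs_arg_le_pi w)
  have h1 := Real.log_le_sub_one_of_pos hp
  have h2 := Real.log_le_sub_one_of_pos (inv_pos.2 hp)
  rw [Real.log_inv] at h2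
  have h3 := inv_pos.2 hp
  exact abs_le.2 ⟨by linarith, by linarith⟩

lemma norm_log_le_of_abs_im {w : ℂ} {c t : ℝ} (hc : |c| ≤ 2) (ht : 1 ≤ |t|)
    (him : |w.im| = √2 / 2 * |t|) (hw : ‖w‖ ≤ |c| + |t|) : ‖Complex.log w‖ ≤ |t| + 8 := by
  have h1 : 1 / 2 ≤ ‖w‖ := by
    refine (half_le_sqrt_two_div_two_mul ht).trans ?_
    rw [← him]
    exact Complex.abs_im_le_norm w
  have hp : 0 < ‖w‖ := by linarith
  have h2 : ‖w‖⁻¹ ≤ 2 := by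
    rw [inv_le_comm₀ hp (by norm_num)]
    linarith
  linarith [norm_log_le (norm_pos_iff.1 hp), Real.pi_lt_four]

lemma norm_cpow_le_exp_s6 {w : ℂ} (hw : w ≠ 0) (z : ℂ) :
    ‖w ^ z‖ ≤ Real.exp (‖z‖ * ‖Complex.log w‖) := by
  rw [Complex.cpow_def_of_ne_zero hw, mul_comm, ← norm_mul]
  exact (Complex.norm_exp_le_exp_norm _)

/-- Integrals of a Gaussian kernel against `exp(z L(t))` with `L` of linear growth are entire. -/
lemma differentiable_integral_gaussian_kernel {c : ℝ} (hc : |c| ≤ 2) {g L : ℝ → ℂ}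
    (hgc : Continuous g) (hLc : Continuous L) (hg : ∀ t, 1 ≤ |t| → ‖g t‖ ≤ gaussWeight c t)
    (hL : ∀ t, 1 ≤ |t| → ‖L t‖ ≤ |t| + 8) :
    Differentiable ℂ fun z => ∫ t, g t * Complex.exp (z * L t) := by
  have hbound : ∀ R : ℝ, 0 ≤ R → Integrable fun t => ‖g t‖ * Real.exp (R * ‖L t‖) := by
    intro R hR
    refine integrable_of_norm_le_exp_neg_abs
      (K := Real.exp (R * 8) * Real.exp ((R + 10) ^ 2)) (by fun_prop) fun t ht => ?_
    rw [Real.norm_of_nonneg (by positivity)]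
    calc ‖g t‖ * Real.exp (R * ‖L t‖) ≤ gaussWeight c t * Real.exp (R * (|t| + 8)) := by
          gcongr
          · exact (norm_nonneg _).trans (hg t ht)
          · exact hg t ht
          · exact hL t ht
      _ = Real.exp (R * 8) * (gaussWeight c t * Real.exp (R * |t|)) := by
          rw [mul_add, Real.exp_add]; ring
      _ ≤ Real.exp (R * 8) * (Real.exp ((R + 10) ^ 2) * Real.exp (-|t|)) := by
          refine mul_le_mul_of_nonneg_left ?_ (Real.exp_pos _).le
          exact gaussWeight_mul_exp_le hc R t
      _ = _ := by ring
  have hexp : ∀ (z : ℂ) (t : ℝ), ‖Complex.exp (z * L t)‖ ≤ Real.exp (‖z‖ * ‖L t‖) := by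
    intro z t
    rw [← norm_mul]
    exact (Complex.norm_exp_le_exp_norm _)
  intro z₀
  refine differentiableAt_integral_mul_exp one_pos hgc.aestronglyMeasurable
    hLc.aestronglyMeasurable ?_ (hbound (‖z₀‖ + 1 + 1) (by positivity))
    (Eventually.of_forall fun t z hz => ?_)
  · refine (hbound ‖z₀‖ (norm_nonneg _)).mono' (by fun_prop) (Eventually.of_forall fun t => ?_)
    rw [norm_mul]
    gcongr
    exact hexp z₀ t
  · have hz' : ‖z‖ ≤ ‖z₀‖ + 1 := by
      rw [Metric.mem_ball, dist_eq_norm] at hz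
      linarith [norm_le_norm_add_norm_sub z z₀, norm_sub_rev z z₀,
        norm_sub_norm_le z z₀]
    rw [norm_mul, norm_mul, add_mul, Real.exp_add, one_mul, mul_comm (Real.exp _)]
    gcongr
    · linarith [Real.add_one_le_exp ‖L t‖]
    · exact (hexp z t).trans (Real.exp_le_exp.2 (by gcongr))

/-- Gaussian decay of a kernel `G E / (e^{iπw} - e^{-iπw})` with `E` of exponential growth. -/
lemma norm_kernel_le {c t k A : ℝ} {G E w : ℂ} (hc : |c| ≤ 2) (ht : 1 ≤ |t|)
    (hG : ‖G‖ = gaussWeight c t) (hE : ‖E‖ ≤ A * Real.exp (k * |t|))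
    (him : |w.im| = √2 / 2 * |t|) :
    ‖G * E / expSubExpNeg w‖ ≤ A * Real.exp ((k + 10) ^ 2) * Real.exp (-|t|) := by
  have hD : 1 ≤ ‖expSubExpNeg w‖ :=
    one_le_norm_expSubExpNeg (him ▸ half_le_sqrt_two_div_two_mul ht)
  have hA : 0 ≤ A := nonneg_of_mul_nonneg_left ((norm_nonneg E).trans hE) (Real.exp_pos _)
  rw [norm_div, norm_mul, hG]
  refine (div_le_self (by unfold gaussWeight; positivity) hD).trans ?_
  calc gaussWeight c t * ‖E‖ ≤ gaussWeight c t * (A * Real.exp (k * |t|)) := by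
        refine mul_le_mul_of_nonneg_left hE (Real.exp_pos _).le
    _ = A * (gaussWeight c t * Real.exp (k * |t|)) := by ring
    _ ≤ A * (Real.exp ((k + 10) ^ 2) * Real.exp (-|t|)) :=
        mul_le_mul_of_nonneg_left (gaussWeight_mul_exp_le hc k t) hA
    _ = _ := by ring

lemma expSubExpNeg_rsLineUp_ne_zero {c t : ℝ} (hc : ∀ n : ℤ, c ≠ n) :
    expSubExpNeg (rsLineUp c t) ≠ 0 := by
  intro h
  obtain ⟨n, hn⟩ := expSubExpNeg_eq_zero_iff.1 h
  have h1 := congrArg Complex.im hn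
  have h2 := congrArg Complex.re hn
  rw [rsLineUp_im, Complex.intCast_im] at h1
  rw [rsLineUp_re, h1, Complex.intCast_re] at h2
  exact hc n (by linarith)

lemma expSubExpNeg_rsLineDown_eq_zero {c t : ℝ} (h : expSubExpNeg (rsLineDown c t) = 0) :
    ∃ n : ℤ, rsLineDown c t = n ∧ c = n := by
  obtain ⟨n, hn⟩ := expSubExpNeg_eq_zero_iff.1 h
  have h1 := congrArg Complex.im hn
  have h2 := congrArg Complex.re hn
  rw [rsLineDown_im, Complex.intCast_im, neg_eq_zero] at h1
  rw [rsLineDown_re, h1, Complex.intCast_re] at h2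
  exact ⟨n, hn, by linarith⟩

lemma ne_intCast_of_mem_Ioo {c : ℝ} {m : ℤ} (hc : c ∈ Ioo (m : ℝ) (m + 1)) (n : ℤ) : c ≠ n := by
  rintro rfl
  have h1 : m < n := by exact_mod_cast hc.1
  have h2 : n < m + 1 := by exact_mod_cast hc.2
  omega

lemma expSubExpNeg_rsLineDown_ne_zero {c t : ℝ} (hc : ∀ n : ℤ, c ≠ n) :
    expSubExpNeg (rsLineDown c t) ≠ 0 := fun h =>
  let ⟨n, _, hn⟩ := expSubExpNeg_rsLineDown_eq_zero h
  hc n hn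

/-- The Mordell integral along the line `rsLineDown c`, as a function of `y`. -/
noncomputable def mordellIntegral (c : ℝ) (y : ℂ) : ℂ :=
  ∫ t : ℝ, Complex.exp (-(I * (π : ℂ) * rsLineDown c t ^ 2)) *
    Complex.exp (2 * (π : ℂ) * I * rsLineDown c t * y) / expSubExpNeg (rsLineDown c t)

lemma norm_exp_two_pi_mul_le {w y : ℂ} {c t : ℝ} (hc : |c| ≤ 2) (hw : ‖w‖ ≤ |c| + |t|) :
    ‖Complex.exp (2 * (π : ℂ) * I * w * y)‖ ≤
      Real.exp (2 * π * ‖y‖ * 2) * Real.exp (2 * π * ‖y‖ * |t|) := by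
  refine (Complex.norm_exp_le_exp_norm _).trans ?_
  rw [← Real.exp_add, Real.exp_le_exp, ← mul_add]
  have h1 : ‖2 * (π : ℂ) * I * w * y‖ = 2 * π * ‖y‖ * ‖w‖ := by
    simp only [norm_mul, Complex.norm_I, Complex.norm_ofNat, Complex.norm_real, norm_eq_abs,
      abs_of_pos Real.pi_pos]
    ring
  rw [h1]
  gcongr
  linarith

lemma integrable_mordell {c : ℝ} (hc2 : |c| ≤ 2) (hc : ∀ n : ℤ, c ≠ n) (y : ℂ) :
    Integrable fun t : ℝ => Complex.exp (-(I * (π : ℂ) * rsLineDown c t ^ 2)) *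
      Complex.exp (2 * (π : ℂ) * I * rsLineDown c t * y) / expSubExpNeg (rsLineDown c t) := by
  have hcont := continuous_rsLineDown c
  have hD := continuous_expSubExpNeg
  refine integrable_of_norm_le_exp_neg_abs
    (K := Real.exp (2 * π * ‖y‖ * 2) * Real.exp ((2 * π * ‖y‖ + 10) ^ 2)) (Continuous.div (by fun_prop) (by fun_prop)
    fun t => expSubExpNeg_rsLineDown_ne_zero hc) fun t ht => ?_
  exact norm_kernel_le hc2 ht (norm_exp_sq_rsLineDown c t)
    (norm_exp_two_pi_mul_le hc2 (norm_rsLineDown_le c t)) (abs_rsLineDown_im c t)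

lemma mordellIntegral_add_one (c : ℝ) (y : ℂ) :
    mordellIntegral (c + 1) y =
      Complex.exp (2 * (π : ℂ) * I * y) * mordellIntegral c (y - 1) := by
  rw [mordellIntegral, mordellIntegral, ← integral_const_mul]
  congr 1
  funext t
  have h1 : rsLineDown (c + 1) t = rsLineDown c t + 1 := by
    simp only [rsLineDown]; push_cast; ring
  rw [h1, expSubExpNeg_add_one]
  set u := rsLineDown c t
  have h2 : Complex.exp (-(I * (π : ℂ) * (u + 1) ^ 2)) *
      Complex.exp (2 * (π : ℂ) * I * (u + 1) * y) =
      Complex.exp (2 * (π : ℂ) * I * y) * (Complex.exp (-(I * (π : ℂ) * u ^ 2)) *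
        Complex.exp (2 * (π : ℂ) * I * u * (y - 1))) * Complex.exp (-(I * (π : ℂ))) := by
    simp only [← Complex.exp_add]
    congr 1
    ring
  rw [h2, Complex.exp_neg (I * (π : ℂ)), exp_I_mul_pi]
  rw [show ((-1 : ℂ))⁻¹ = -1 by norm_num, mul_neg_one, neg_div_neg_eq, mul_div_assoc]

lemma exp_neg_I_pi_div_four_sq : Complex.exp (-(I * (π : ℂ) / 4)) ^ 2 = -I := by
  rw [← Complex.exp_nat_mul, show ((2 : ℕ) : ℂ) * (-(I * (π : ℂ) / 4)) = -(π / 2 * I) by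
    push_cast; ring, Complex.exp_neg, Complex.exp_pi_div_two_mul_I, Complex.inv_I]

lemma mordellIntegral_sub {c : ℝ} (hc2 : |c| ≤ 2) (hc : ∀ n : ℤ, c ≠ n) (y : ℂ) :
    Complex.exp (-(I * (π : ℂ) / 4)) * (mordellIntegral c y - mordellIntegral c (y - 1)) =
      Complex.exp (I * (π : ℂ) * y ^ 2) * Complex.exp (-(I * (π : ℂ) * y)) := by
  have hpi : (π : ℂ) ≠ 0 := by exact_mod_cast Real.pi_ne_zero
  rw [mordellIntegral, mordellIntegral, ← integral_sub (integrable_mordell hc2 hc y)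
    (integrable_mordell hc2 hc (y - 1))]
  set e : ℂ := Complex.exp (-(I * (π : ℂ) / 4)) with he
  have h1 : ∀ t : ℝ, Complex.exp (-(I * (π : ℂ) * rsLineDown c t ^ 2)) *
      Complex.exp (2 * (π : ℂ) * I * rsLineDown c t * y) / expSubExpNeg (rsLineDown c t) -
      Complex.exp (-(I * (π : ℂ) * rsLineDown c t ^ 2)) *
      Complex.exp (2 * (π : ℂ) * I * rsLineDown c t * (y - 1)) / expSubExpNeg (rsLineDown c t) =
      Complex.exp (-(π : ℂ) * (t : ℂ) ^ 2 + 2 * (π : ℂ) * I * e * (y - 1 / 2 - c) * t +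
        (-(I * (π : ℂ) * c ^ 2) + 2 * (π : ℂ) * I * c * (y - 1 / 2))) := by
    intro t
    have hD := expSubExpNeg_rsLineDown_ne_zero (t := t) hc
    rw [← sub_div, div_eq_iff hD]
    have h2 : -(π : ℂ) * (t : ℂ) ^ 2 + 2 * (π : ℂ) * I * e * (y - 1 / 2 - c) * t +
        (-(I * (π : ℂ) * c ^ 2) + 2 * (π : ℂ) * I * c * (y - 1 / 2)) =
        -(I * (π : ℂ) * rsLineDown c t ^ 2) +
          2 * (π : ℂ) * I * rsLineDown c t * (y - 1 / 2) := by
      have he2 := exp_neg_I_pi_div_four_sq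
      rw [← he] at he2
      rw [rsLineDown, ← he]
      linear_combination (I * π * t ^ 2) * he2 - (π * t ^ 2 : ℂ) * Complex.I_sq
    have h3 : Complex.exp (2 * (π : ℂ) * I * rsLineDown c t * y) -
        Complex.exp (2 * (π : ℂ) * I * rsLineDown c t * (y - 1)) =
        Complex.exp (2 * (π : ℂ) * I * rsLineDown c t * (y - 1 / 2)) *
          expSubExpNeg (rsLineDown c t) := by
      rw [expSubExpNeg, mul_sub (Complex.exp _), ← Complex.exp_add, ← Complex.exp_add]
      congr 2 <;> ring
    rw [h2, ← mul_sub, h3, Complex.exp_add, mul_assoc (Complex.exp (-(I * (π : ℂ) * _)))]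
  simp_rw [h1]
  rw [integral_cexp_quadratic (by simpa using Real.pi_pos), neg_neg, div_self hpi,
    Complex.one_cpow, one_mul, he, ← Complex.exp_add, ← Complex.exp_add, ← he]
  congr 1
  have he2 := exp_neg_I_pi_div_four_sq
  rw [← he] at he2
  have hC : (2 * (π : ℂ) * I * e * (y - 1 / 2 - c)) ^ 2 / (4 * -(π : ℂ)) =
      -(π * I ^ 2 * e ^ 2 * (y - 1 / 2 - c) ^ 2) := by
    field_simp
    ring
  rw [hC, he2, Complex.I_sq]
  ring

lemma dslope_div_dslope {f g : ℂ → ℂ} {a z : ℂ} (hf : f a = 0) (hg : g a = 0) (hz : z ≠ a) :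
    dslope f a z / dslope g a z = f z / g z := by
  have : z - a ≠ 0 := sub_ne_zero.2 hz
  rw [dslope_of_ne f hz, dslope_of_ne g hz, slope_def_field, slope_def_field, hf, hg, sub_zero,
    sub_zero, div_div_div_cancel_right₀ this]

lemma deriv_expSubExpNeg (w : ℂ) : deriv expSubExpNeg w =
    I * (π : ℂ) * (Complex.exp (I * (π : ℂ) * w) + Complex.exp (-(I * (π : ℂ) * w))) := by
  have h := ((hasDerivAt_id w).const_mul (I * (π : ℂ)))
  have h2 := (h.cexp.sub h.neg.cexp).deriv
  refine Eq.trans h2 ?_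
  simp only [id, mul_one, Pi.neg_apply]
  ring

lemma mordellIntegral_sub_add_one {c : ℝ} (hc : c ∈ Ioo (0 : ℝ) 1) (y : ℂ) :
    mordellIntegral c y - mordellIntegral (c + 1) y = Complex.exp (2 * (π : ℂ) * I * (y - 1)) *
      (mordellIntegral c 1 - mordellIntegral (c + 1) 1) := by
  have hpi : (π : ℂ) ≠ 0 := by exact_mod_cast Real.pi_ne_zero
  set q : ℂ := Complex.exp (2 * (π : ℂ) * I * (y - 1)) with hq
  set N : ℂ → ℂ := fun u => Complex.exp (-(I * (π : ℂ) * u ^ 2)) *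
    (Complex.exp (2 * (π : ℂ) * I * u * y) - q * Complex.exp (2 * (π : ℂ) * I * u * 1)) with hN
  have hNd : Differentiable ℂ N := by rw [hN]; fun_prop
  have hN1 : N 1 = 0 := by
    have : Complex.exp (2 * (π : ℂ) * I * 1 * y) - q * Complex.exp (2 * (π : ℂ) * I * 1 * 1)
        = 0 := by
      rw [hq, ← Complex.exp_add, sub_eq_zero]
      congr 1
      ring
    simp only [hN, this, mul_zero]
  have hD1 : expSubExpNeg 1 = 0 := expSubExpNeg_eq_zero_iff.2 ⟨1, by simp⟩
  have hD1' : dslope expSubExpNeg 1 1 ≠ 0 := by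
    rw [dslope_same, deriv_expSubExpNeg, mul_one, Complex.exp_neg, exp_I_mul_pi]
    norm_num [hpi]
  set F : ℂ → ℂ := fun u => dslope N 1 u / dslope expSubExpNeg 1 u with hF
  have hFeq : ∀ u ≠ 1, F u = N u / expSubExpNeg u := fun u hu => dslope_div_dslope hN1 hD1 hu
  have hFd : ∀ u ≠ 1, expSubExpNeg u ≠ 0 → DifferentiableAt ℂ F u := by
    intro u hu hDu
    have : (fun u => N u / expSubExpNeg u) =ᶠ[𝓝 u] F := by
      filter_upwards [isOpen_ne.mem_nhds hu] with v hv
      exact (hFeq v hv).symm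
    exact this.differentiableAt_iff.1 ((hNd u).div (differentiable_expSubExpNeg u) hDu)
  have hFc : ContinuousAt F 1 :=
    (continuousAt_dslope_same.2 (hNd 1)).div
      (continuousAt_dslope_same.2 (differentiable_expSubExpNeg 1)) hD1'
  have hpts : ∀ c' ∈ Icc c (c + 1), ∀ t : ℝ, rsLineDown c' t ≠ 1 →
      expSubExpNeg (rsLineDown c' t) ≠ 0 := by
    intro c' hc' t hne h0
    obtain ⟨n, hn, rfl⟩ := expSubExpNeg_rsLineDown_eq_zero h0
    have h1 : (0 : ℝ) < n := hc.1.trans_le hc'.1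
    have h2 : (n : ℝ) < 2 := by linarith [hc'.2, hc.2]
    have h3 : n = 1 := by
      have h4 : (0 : ℤ) < n := by exact_mod_cast h1
      have h5 : n < (2 : ℤ) := by exact_mod_cast h2
      omega
    exact hne (by rw [hn, h3]; simp)
  have habs : ∀ c' ∈ Icc c (c + 1), |c'| ≤ 2 := fun c' hc' =>
    abs_le.2 ⟨by linarith [hc.1, hc'.1], by linarith [hc.2, hc'.2]⟩
  set k : ℝ := 2 * π * (‖y‖ + 1) with hk
  have hshift := integral_parallel_lines_eq norm_exp_neg_I_pi_div_four (a := c) (b := c + 1)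
    (by linarith) (F := F) (S := {1}) (countable_singleton _)
    (K := (Real.exp (2 * π * ‖y‖ * 2) + ‖q‖ * Real.exp (2 * π * ‖(1 : ℂ)‖ * 2)) *
      Real.exp ((k + 10) ^ 2)) ?_ ?_ ?_
  · have hline : ∀ c' : ℝ, |c'| ≤ 2 → (∀ n : ℤ, c' ≠ n) →
        ∫ t : ℝ, F (rsLineDown c' t) = mordellIntegral c' y - q * mordellIntegral c' 1 := by
      intro c' hc2 hn
      rw [mordellIntegral, mordellIntegral, ← integral_const_mul,
        ← integral_sub (integrable_mordell hc2 hn y) ((integrable_mordell hc2 hn 1).const_mul q)]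
      congr 1
      funext t
      have hne : rsLineDown c' t ≠ 1 := by
        intro h
        exact expSubExpNeg_rsLineDown_ne_zero hn (t := t) (h ▸ hD1)
      rw [hFeq _ hne, hN]
      ring
    have h1 := hline c (habs c ⟨le_rfl, by linarith⟩)
      (ne_intCast_of_mem_Ioo (m := 0) (by simpa using hc))
    have h2 := hline (c + 1) (habs _ ⟨by linarith, le_rfl⟩)
      (ne_intCast_of_mem_Ioo (m := 1) ⟨by simpa using hc.1, by simpa using hc.2⟩)
    have h3 : mordellIntegral c y - q * mordellIntegral c 1 =
        mordellIntegral (c + 1) y - q * mordellIntegral (c + 1) 1 := by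
      rw [← h1, ← h2]
      exact hshift
    linear_combination h3
  · intro c' hc' t
    by_cases h : rsLineDown c' t = 1
    · rw [← rsLineDown, h]; exact hFc
    · exact (hFd _ h (hpts c' hc' t h)).continuousAt
  · intro c' hc' t h
    exact hFd _ h (hpts c' hc' t h)
  · intro c' hc' t ht
    have hne : rsLineDown c' t ≠ 1 := by
      intro h
      have h2 := abs_rsLineDown_im c' t
      rw [h] at h2
      have := half_le_sqrt_two_div_two_mul ht
      simp at h2
      subst h2
      norm_num at ht
    rw [← rsLineDown, hFeq _ hne, hN]
    refine norm_kernel_le (habs c' hc') ht (norm_exp_sq_rsLineDown c' t) ?_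
      (abs_rsLineDown_im c' t)
    have hB : ∀ z : ℂ, ‖z‖ ≤ ‖y‖ + 1 →
        ‖Complex.exp (2 * (π : ℂ) * I * rsLineDown c' t * z)‖ ≤
        Real.exp (2 * π * ‖z‖ * 2) * Real.exp (k * |t|) := fun z hz =>
      (norm_exp_two_pi_mul_le (habs c' hc') (norm_rsLineDown_le c' t)).trans (by rw [hk]; gcongr)
    refine (norm_sub_le _ _).trans ?_
    rw [norm_mul, add_mul, mul_assoc ‖q‖]
    exact add_le_add (hB y (by linarith)) (mul_le_mul_of_nonneg_left
      (hB 1 (by simp)) (norm_nonneg q))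

/-- Mordell's closed form for the integral of `e^{-iπu² + 2πiuy} / (2i sin(πu))`. -/
theorem mordellIntegral_eq {c : ℝ} (hc : c ∈ Ioo (0 : ℝ) 1) {y : ℂ} (hy : expSubExpNeg y ≠ 0) :
    Complex.exp (-(I * (π : ℂ) / 4)) * mordellIntegral c y =
      1 / (Complex.exp (-(2 * (π : ℂ) * I * y)) - 1) +
        Complex.exp (I * (π : ℂ) * y ^ 2) / expSubExpNeg y := by
  have hc2 : |c| ≤ 2 := abs_le.2 ⟨by linarith [hc.1], by linarith [hc.2]⟩
  have hn := ne_intCast_of_mem_Ioo (m := 0) (by simpa using hc)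
  have h1 := mordellIntegral_sub hc2 hn y
  have h2 := mordellIntegral_sub hc2 hn 1
  have h3 := mordellIntegral_sub_add_one hc y
  rw [mordellIntegral_add_one, mordellIntegral_add_one] at h3
  have h4 : Complex.exp (2 * (π : ℂ) * I * 1) = 1 := by
    rw [mul_one, Complex.exp_two_pi_mul_I]
  rw [show 2 * (π : ℂ) * I * (y - 1) = 2 * π * I * y - 2 * π * I * 1 by ring, Complex.exp_sub, h4,
    one_mul, div_one] at h3
  rw [one_pow, mul_one, ← Complex.exp_add, add_neg_cancel, Complex.exp_zero] at h2
  set r := Complex.exp (I * (π : ℂ) * y) with hr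
  have hr0 : r ≠ 0 := Complex.exp_ne_zero _
  have hq : Complex.exp (2 * (π : ℂ) * I * y) = r ^ 2 := by
    rw [hr, ← Complex.exp_nat_mul]; congr 1; push_cast; ring
  rw [Complex.exp_neg (I * (π : ℂ) * y), ← hr] at h1
  rw [hq] at h3
  rw [expSubExpNeg, Complex.exp_neg (I * (π : ℂ) * y), ← hr] at hy ⊢
  rw [Complex.exp_neg (2 * (π : ℂ) * I * y), hq]
  have hr1 : r ^ 2 - 1 ≠ 0 := by
    intro h
    apply hy
    field_simp
    rw [h, mul_zero]
  have hr2 : 1 - r ^ 2 ≠ 0 := by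
    intro h
    apply hr1
    linear_combination -h
  set e := Complex.exp (-(I * (π : ℂ) / 4))
  set E := Complex.exp (I * (π : ℂ) * y ^ 2)
  have h5 : e * mordellIntegral c y * (1 - r ^ 2) = r ^ 2 - r * E := by
    have h6 : r ^ 2 * (E * r⁻¹) = r * E := by field_simp
    linear_combination e * h3 - r ^ 2 * h1 + r ^ 2 * h2 - h6
  have h7 : 1 / ((r ^ 2)⁻¹ - 1) + E / (r - r⁻¹) = (r ^ 2 - r * E) / (1 - r ^ 2) := by
    have h8 : (r ^ 2)⁻¹ - 1 = (1 - r ^ 2) / r ^ 2 := by field_simp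
    have h9 : r - r⁻¹ = (r ^ 2 - 1) / r := by field_simp
    rw [h8, h9]
    field_simp
    ring
  rw [h7, eq_div_iff hr2, h5]

lemma norm_cpow_mul_exp_neg_mul {a r : ℂ} {t : ℝ} (ht : 0 < t) :
    ‖(t : ℂ) ^ (a - 1) * Complex.exp (-(r * t))‖ = t ^ (a.re - 1) * Real.exp (-r.re * t) := by
  rw [norm_mul, Complex.norm_cpow_eq_rpow_re_of_pos ht, Complex.norm_exp]
  simp

lemma continuousOn_ofReal_cpow (a : ℂ) : ContinuousOn (fun t : ℝ => (t : ℂ) ^ a) (Ioi 0) :=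
  fun _ ht => (Complex.continuousAt_ofReal_cpow_const _ _ (Or.inr (ne_of_gt ht)))
    |>.continuousWithinAt

lemma integrableOn_rpow_mul_exp_neg {a b : ℝ} (ha : 0 < a) (hb : 0 < b) :
    IntegrableOn (fun t : ℝ => t ^ (a - 1) * Real.exp (-b * t)) (Ioi 0) := by
  have := integrableOn_rpow_mul_exp_neg_mul_rpow (p := 1) (s := a - 1) (b := b) (by linarith)
    one_pos hb
  simpa using this

lemma integrableOn_cpow_mul_exp_neg {a r : ℂ} (ha : 0 < a.re) (hr : 0 < r.re) :
    IntegrableOn (fun t : ℝ => (t : ℂ) ^ (a - 1) * Complex.exp (-(r * t))) (Ioi 0) := by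
  refine Integrable.mono' (integrableOn_rpow_mul_exp_neg ha hr) ?_ ?_
  · exact ((continuousOn_ofReal_cpow _).mul
      (by fun_prop : Continuous fun t : ℝ => Complex.exp (-(r * t))).continuousOn)
      |>.aestronglyMeasurable measurableSet_Ioi
  · filter_upwards [ae_restrict_mem measurableSet_Ioi] with t ht
    exact (norm_cpow_mul_exp_neg_mul ht).le

/-- Euler's integral `∫ t^{a-1} e^{-rt} dt = r^{-a} Γ(a)` for complex `r` in the right half-plane. -/
theorem integral_cpow_mul_exp_neg_mul_complex {a r : ℂ} (ha : 0 < a.re) (hr : 0 < r.re) :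
    ∫ t : ℝ in Ioi 0, (t : ℂ) ^ (a - 1) * Complex.exp (-(r * t)) =
      r ^ (-a) * Complex.Gamma a := by
  set U : Set ℂ := {z | 0 < z.re} with hU
  have hUo : IsOpen U := isOpen_lt continuous_const Complex.continuous_re
  have hUc : IsPreconnected U := (convex_halfSpace_re_gt 0).isPreconnected
  have hf : AnalyticOnNhd ℂ (fun z : ℂ => ∫ t : ℝ in Ioi 0,
      (t : ℂ) ^ (a - 1) * Complex.exp (z * (-t : ℂ))) U := by
    refine DifferentiableOn.analyticOnNhd (fun z hz => ?_) hUo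
    have hz' : 0 < z.re := hz
    refine (differentiableAt_integral_mul_exp (ε := z.re / 2)
      (b := fun t => t ^ (a.re + 1 - 1) * Real.exp (-(z.re / 2) * t)) (half_pos hz)
      ((continuousOn_ofReal_cpow _).aestronglyMeasurable measurableSet_Ioi)
      (by fun_prop : Continuous fun t : ℝ => (-t : ℂ)).aestronglyMeasurable ?_
      (integrableOn_rpow_mul_exp_neg (by linarith) (half_pos hz')) ?_).differentiableWithinAt
    · simpa [IntegrableOn] using integrableOn_cpow_mul_exp_neg ha hz'
    · filter_upwards [ae_restrict_mem measurableSet_Ioi] with t ht v hv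
      have ht' : 0 < t := ht
      have hv2 : z.re / 2 ≤ v.re := by
        have h1 := (Complex.abs_re_le_norm (v - z)).trans
          (mem_ball_iff_norm.1 hv).le
        rw [Complex.sub_re] at h1
        linarith [(abs_le.1 h1).1]
      have h3 : (t : ℂ) ^ (a - 1) * ((-t : ℂ) * Complex.exp (v * (-t : ℂ))) =
          -(t * ((t : ℂ) ^ (a - 1) * Complex.exp (-(v * t)))) := by
        rw [mul_neg v]; ring
      rw [h3, norm_neg, norm_mul, norm_cpow_mul_exp_neg_mul ht, Complex.norm_real,
        Real.norm_of_nonneg ht'.le, ← mul_assoc, add_sub_cancel_right]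
      have h4 : t * t ^ (a.re - 1) = t ^ a.re := by
        rw [mul_comm, ← Real.rpow_add_one ht'.ne', sub_add_cancel]
      rw [h4]
      gcongr
  have hg : AnalyticOnNhd ℂ (fun z : ℂ => z ^ (-a) * Complex.Gamma a) U := by
    refine DifferentiableOn.analyticOnNhd (fun z hz => ?_) hUo
    exact ((differentiableAt_id.cpow_const (Or.inl hz)).mul_const _).differentiableWithinAt
  have h1 : (1 : ℂ) ∈ U := by simp [hU]
  have hfreq : ∃ᶠ z in 𝓝[≠] (1 : ℂ), (∫ t : ℝ in Ioi 0,
      (t : ℂ) ^ (a - 1) * Complex.exp (z * (-t : ℂ))) = z ^ (-a) * Complex.Gamma a := by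
    have htend : Tendsto (fun x : ℝ => (x : ℂ)) (𝓝[≠] 1) (𝓝[≠] 1) := by
      refine tendsto_nhdsWithin_iff.2 ⟨?_, ?_⟩
      · exact (Complex.continuous_ofReal.tendsto' 1 1 (by simp)).mono_left nhdsWithin_le_nhds
      · filter_upwards [self_mem_nhdsWithin] with x hx
        simpa using hx
    refine htend.frequently (Eventually.frequently ?_)
    filter_upwards [nhdsWithin_le_nhds (lt_mem_nhds (zero_lt_one' ℝ))] with x hx
    simp_rw [mul_neg]
    rw [Complex.integral_cpow_mul_exp_neg_mul_Ioi ha (by simpa using hx), one_div,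
      Complex.inv_cpow _ _ (by rw [Complex.arg_ofReal_of_nonneg hx.le]; exact Real.pi_pos.ne),
      Complex.cpow_neg]
  have := hf.eqOn_of_preconnected_of_frequently_eq hg hUc h1 hfreq hr
  simpa using this

lemma mul_cpow_of_arg_add_mem {x y : ℂ} (hx : x ≠ 0) (hy : y ≠ 0)
    (h : x.arg + y.arg ∈ Ioc (-π) π) (w : ℂ) : (x * y) ^ w = x ^ w * y ^ w := by
  rw [Complex.cpow_def_of_ne_zero (mul_ne_zero hx hy), Complex.cpow_def_of_ne_zero hx,
    Complex.cpow_def_of_ne_zero hy, Complex.log_mul hx hy h, add_mul, Complex.exp_add]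

lemma ofReal_mul_cpow {r : ℝ} (hr : 0 < r) {y : ℂ} (hy : y ≠ 0) (w : ℂ) :
    ((r : ℂ) * y) ^ w = (r : ℂ) ^ w * y ^ w := by
  refine mul_cpow_of_arg_add_mem (by exact_mod_cast hr.ne') hy ?_ w
  rw [Complex.arg_ofReal_of_nonneg hr.le, zero_add]
  exact ⟨Complex.neg_pi_lt_arg y, Complex.arg_le_pi y⟩

lemma exp_mul_I_cpow {θ : ℝ} (h : θ ∈ Ioc (-π) π) (w : ℂ) :
    Complex.exp (θ * I) ^ w = Complex.exp (θ * I * w) := by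
  rw [Complex.cpow_def_of_ne_zero (Complex.exp_ne_zero _), Complex.log_exp]
  · simpa using h.1
  · simpa using h.2

lemma exp_I_pi_div_four_mul_exp_neg :
    Complex.exp (I * (π : ℂ) / 4) * Complex.exp (-(I * (π : ℂ) / 4)) = 1 := by
  rw [← Complex.exp_add, add_neg_cancel, Complex.exp_zero]

lemma exp_neg_I_pi_div_four_mul_cpow {u : ℂ}
    (hu : 0 < (Complex.exp (-(I * (π : ℂ) / 4)) * u).re) (w : ℂ) :
    (Complex.exp (-(I * (π : ℂ) / 4)) * u) ^ w = Complex.exp (-(I * (π : ℂ) / 4 * w)) * u ^ w := by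
  set v := Complex.exp (-(I * (π : ℂ) / 4)) * u with hv
  have hv0 : v ≠ 0 := by rintro h; simp [h] at hu
  have huv : u = Complex.exp ((π / 4 : ℝ) * I) * v := by
    rw [hv, ← mul_assoc, show ((π / 4 : ℝ) : ℂ) * I = I * π / 4 by push_cast; ring,
      exp_I_pi_div_four_mul_exp_neg, one_mul]
  have hpi := Real.pi_pos
  have hmem : π / 4 ∈ Ioc (-π) π := ⟨by linarith, by linarith⟩
  have harg := Complex.abs_arg_lt_pi_div_two_iff.2 (Or.inl hu)
  have h1 := abs_lt.1 harg
  rw [huv, mul_cpow_of_arg_add_mem (Complex.exp_ne_zero _) hv0 ?_ w, exp_mul_I_cpow hmem,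
    ← mul_assoc, ← Complex.exp_add]
  · rw [show -(I * (π : ℂ) / 4 * w) + (π / 4 : ℝ) * I * w = 0 by push_cast; ring,
      Complex.exp_zero, one_mul]
  · rw [Complex.exp_mul_I, Complex.arg_cos_add_sin_mul_I hmem]
    exact ⟨by linarith [h1.1], by linarith [h1.2]⟩

lemma exp_neg_I_pi_div_four_mul_rsLineDown_re (c t : ℝ) :
    (Complex.exp (-(I * (π : ℂ) / 4)) * rsLineDown c t).re = √2 / 2 * c := by
  rw [Complex.mul_re, rsLineDown_re, rsLineDown_im, exp_neg_I_pi_div_four]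
  simp
  ring

lemma I_mul_exp_I_pi_div_four :
    I * Complex.exp (I * (π : ℂ) / 4) = -Complex.exp (-(I * (π : ℂ) / 4)) := by
  rw [exp_I_pi_div_four, exp_neg_I_pi_div_four]
  linear_combination ((√2 / 2 : ℝ) : ℂ) * Complex.I_sq

lemma rsLineDown_ne_zero {c : ℝ} (hc : c ≠ 0) (t : ℝ) : rsLineDown c t ≠ 0 := by
  intro h
  have h1 := congrArg Complex.re h
  have h2 := congrArg Complex.im h
  rw [rsLineDown_re, Complex.zero_re] at h1
  rw [rsLineDown_im, Complex.zero_im] at h2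
  exact hc (by linarith)

/-- The common factor `Γ(a) (2π e^{-iπ/4})^{-a}` of the Mellin transforms along `e^{iπ/4} ℝ₊`. -/
noncomputable def mellinFactor (a : ℂ) : ℂ :=
  Complex.Gamma a * ((2 * π : ℝ) : ℂ) ^ (-a) * Complex.exp (I * (π : ℂ) / 4 * a)

lemma integral_cpow_mul_exp_two_pi_mul {a u : ℂ} (ha : 0 < a.re)
    (hu : 0 < (Complex.exp (-(I * (π : ℂ) / 4)) * u).re) :
    ∫ ρ : ℝ in Ioi 0, (ρ : ℂ) ^ (a - 1) * Complex.exp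
      (-(((2 * π : ℝ) : ℂ) * (Complex.exp (-(I * (π : ℂ) / 4)) * u) * ρ)) =
      mellinFactor a * u ^ (-a) := by
  have hv0 : Complex.exp (-(I * (π : ℂ) / 4)) * u ≠ 0 := by rintro h; simp [h] at hu
  rw [integral_cpow_mul_exp_neg_mul_complex ha, ofReal_mul_cpow (by positivity) hv0,
    exp_neg_I_pi_div_four_mul_cpow hu, mellinFactor, mul_neg, neg_neg]
  · ring
  · rw [Complex.re_ofReal_mul]
    positivity

lemma hasSum_exp_neg_mul {x : ℂ} (hx : 0 < x.re) :
    HasSum (fun n : ℕ => Complex.exp (-((n + 1) * x))) (1 / (Complex.exp x - 1)) := by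
  have hq : ‖Complex.exp (-x)‖ < 1 := by
    rw [Complex.norm_exp, Real.exp_lt_one_iff]
    simpa using hx
  have hx1 : Complex.exp x - 1 ≠ 0 := by
    intro h
    rw [sub_eq_zero] at h
    rw [Complex.exp_neg, h] at hq
    simp at hq
  have h1 := (hasSum_geometric_of_norm_lt_one hq).mul_left (Complex.exp (-x))
  have h2 : Complex.exp (-x) * (1 - Complex.exp (-x))⁻¹ = 1 / (Complex.exp x - 1) := by
    have h0 := Complex.exp_ne_zero x
    rw [Complex.exp_neg, show 1 - (Complex.exp x)⁻¹ = (Complex.exp x - 1) / Complex.exp x by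
      field_simp]
    field_simp
  rw [h2] at h1
  refine h1.congr_fun fun n => ?_
  rw [← Complex.exp_nat_mul, ← Complex.exp_add]
  congr 1
  ring

lemma norm_one_div_exp_sub_one_le {x : ℂ} (hx : 0 < x.re) :
    ‖1 / (Complex.exp x - 1)‖ ≤ x.re⁻¹ * Real.exp (-(x.re / 2)) := by
  have h1 : x.re / 2 ≤ Real.sinh (x.re / 2) := Real.self_le_sinh_iff.2 (by positivity)
  have h2 : x.re * Real.exp (x.re / 2) ≤ ‖Complex.exp x - 1‖ := by
    have h3 := norm_sub_norm_le (Complex.exp x) 1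
    rw [Complex.norm_exp, norm_one] at h3
    refine le_trans ?_ h3
    have h4 : Real.exp x.re = Real.exp (x.re / 2) * Real.exp (x.re / 2) := by
      rw [← Real.exp_add, add_halves]
    have h5 : Real.exp (x.re / 2) * Real.exp (-(x.re / 2)) = 1 := by
      rw [← Real.exp_add, add_neg_cancel, Real.exp_zero]
    rw [Real.sinh_eq] at h1
    nlinarith [mul_le_mul_of_nonneg_left h1 (Real.exp_pos (x.re / 2)).le]
  rw [norm_div, norm_one, Real.exp_neg, ← mul_inv, ← one_div]
  exact one_div_le_one_div_of_le (by positivity) h2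

lemma two_pi_mul_exp_neg_I_pi_div_four_re (ρ : ℝ) :
    (((2 * π : ℝ) : ℂ) * Complex.exp (-(I * (π : ℂ) / 4)) * ρ).re = √2 * π * ρ := by
  rw [mul_assoc, Complex.re_ofReal_mul, Complex.re_mul_ofReal, exp_neg_I_pi_div_four]
  simp
  ring

lemma integrableOn_cpow_mul_one_div_exp_sub_one {a : ℂ} (ha : 1 < a.re) :
    IntegrableOn (fun ρ : ℝ => (ρ : ℂ) ^ (a - 1) *
      (1 / (Complex.exp (((2 * π : ℝ) : ℂ) * Complex.exp (-(I * (π : ℂ) / 4)) * ρ) - 1)))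
      (Ioi 0) := by
  set e : ℂ := ((2 * π : ℝ) : ℂ) * Complex.exp (-(I * (π : ℂ) / 4)) with he
  have hre : ∀ ρ : ℝ, (e * ρ).re = √2 * π * ρ := two_pi_mul_exp_neg_I_pi_div_four_re
  have hpos : ∀ ρ ∈ Ioi (0 : ℝ), 0 < (e * ρ).re := fun ρ hρ => by
    rw [hre]
    have : 0 < ρ := hρ
    positivity
  have hb := (integrableOn_rpow_mul_exp_neg (a := a.re - 1) (b := √2 * π / 2) (by linarith)
    (by positivity)).const_mul (√2 * π)⁻¹
  refine Integrable.mono' hb ?_ ?_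
  · refine ((continuousOn_ofReal_cpow _).mul (ContinuousOn.div (by fun_prop)
      (by fun_prop) fun ρ hρ h => ?_)).aestronglyMeasurable measurableSet_Ioi
    have h1 := congrArg norm (sub_eq_zero.1 h)
    rw [Complex.norm_exp, norm_one, Real.exp_eq_one_iff] at h1
    exact (hpos ρ hρ).ne' h1
  · filter_upwards [ae_restrict_mem measurableSet_Ioi] with ρ hρ
    have hρ' : 0 < ρ := hρ
    rw [norm_mul, Complex.norm_cpow_eq_rpow_re_of_pos hρ]
    refine (mul_le_mul_of_nonneg_left (norm_one_div_exp_sub_one_le (hpos ρ hρ))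
      (by positivity)).trans (le_of_eq ?_)
    rw [hre, mul_inv, Complex.sub_re, Complex.one_re, Real.rpow_sub_one hρ'.ne' (a.re - 1),
      show -(√2 * π * ρ / 2) = -(√2 * π / 2) * ρ by ring]
    ring

lemma integral_cpow_mul_one_div_exp_sub_one {a : ℂ} (ha : 1 < a.re) :
    ∫ ρ : ℝ in Ioi 0, (ρ : ℂ) ^ (a - 1) *
      (1 / (Complex.exp (((2 * π : ℝ) : ℂ) * Complex.exp (-(I * (π : ℂ) / 4)) * ρ) - 1)) =
      mellinFactor a * riemannZeta a := by
  have ha0 : 0 < a.re := one_pos.trans ha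
  set e : ℂ := ((2 * π : ℝ) : ℂ) * Complex.exp (-(I * (π : ℂ) / 4)) with he
  have hre : ∀ ρ : ℝ, (e * ρ).re = √2 * π * ρ := two_pi_mul_exp_neg_I_pi_div_four_re
  have he1 : e.re = √2 * π := by simpa using hre 1
  set F : ℕ → ℝ → ℂ := fun n ρ => (ρ : ℂ) ^ (a - 1) * Complex.exp (-((n + 1 : ℂ) * e * ρ))
    with hF
  have hren : ∀ n : ℕ, ((n + 1 : ℂ) * e).re = (n + 1) * (√2 * π) := fun n => by
    rw [← he1]
    have := Complex.re_ofReal_mul (n + 1) e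
    push_cast at this
    exact this
  have hint : ∀ n, Integrable (F n) (volume.restrict (Ioi 0)) := fun n =>
    integrableOn_cpow_mul_exp_neg ha0 (by rw [hren]; positivity)
  have hval : ∀ n : ℕ, ∫ ρ in Ioi 0, F n ρ = mellinFactor a * (1 / (n + 1 : ℂ) ^ a) := fun n => by
    have hu : 0 < (Complex.exp (-(I * (π : ℂ) / 4)) * (n + 1 : ℂ)).re := by
      rw [exp_neg_I_pi_div_four]
      simp
      positivity
    have h1 := integral_cpow_mul_exp_two_pi_mul ha0 hu
    rw [Complex.cpow_neg] at h1
    rw [one_div, ← h1]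
    refine setIntegral_congr_fun measurableSet_Ioi fun ρ _ => ?_
    have h2 : (n + 1 : ℂ) * e * ρ =
        ((2 * π : ℝ) : ℂ) * (Complex.exp (-(I * (π : ℂ) / 4)) * (n + 1 : ℂ)) * ρ := by
      rw [he]; ring
    simp only [hF, h2]
  have hnorm : ∀ n : ℕ, ∫ ρ in Ioi 0, ‖F n ρ‖ =
      Real.Gamma a.re * (1 / (√2 * π)) ^ a.re * (1 / (n + 1 : ℝ) ^ a.re) := fun n => by
    have h1 := Real.integral_rpow_mul_exp_neg_mul_Ioi ha0
      (by positivity : 0 < (n + 1 : ℝ) * (√2 * π))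
    have h2 : (1 / ((n + 1 : ℝ) * (√2 * π))) ^ a.re =
        (1 / (√2 * π)) ^ a.re * (1 / (n + 1 : ℝ) ^ a.re) := by
      rw [← Real.one_rpow a.re, ← Real.div_rpow (by norm_num) (by positivity), Real.one_rpow,
        ← Real.mul_rpow (by positivity) (by positivity)]
      congr 1
      field_simp
    rw [mul_assoc, ← h2, mul_comm, ← h1]
    refine setIntegral_congr_fun measurableSet_Ioi fun ρ hρ => ?_
    rw [hF]
    dsimp only
    rw [norm_cpow_mul_exp_neg_mul hρ, hren, neg_mul]
  have hsum : Summable fun n : ℕ => ∫ ρ in Ioi 0, ‖F n ρ‖ := by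
    simp_rw [hnorm]
    refine Summable.mul_left _ ?_
    have := (summable_nat_add_iff 1).2 (Real.summable_one_div_nat_rpow.2 ha)
    simpa using this
  have hmain := (hasSum_integral_of_summable_integral_norm hint hsum).tsum_eq
  rw [zeta_eq_tsum_one_div_nat_add_one_cpow ha, ← tsum_mul_left]
  simp_rw [← hval]
  rw [hmain]
  refine setIntegral_congr_fun measurableSet_Ioi fun ρ hρ => ?_
  have hρ' : 0 < ρ := hρ
  have h3 := (hasSum_exp_neg_mul (x := e * ρ) (by rw [hre]; positivity)).mul_left
    ((ρ : ℂ) ^ (a - 1))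
  rw [← h3.tsum_eq]
  refine tsum_congr fun n => ?_
  rw [hF]
  dsimp only
  rw [mul_assoc (n + 1 : ℂ)]

lemma integrable_prod_mordell {c : ℝ} (hc : c ∈ Ioo (0 : ℝ) 1) {a : ℂ} (ha : 0 < a.re) :
    Integrable (Function.uncurry fun ρ t : ℝ => (ρ : ℂ) ^ (a - 1) *
      (Complex.exp (-(I * (π : ℂ) * rsLineDown c t ^ 2)) * Complex.exp (2 * (π : ℂ) * I *
        rsLineDown c t * (Complex.exp (I * (π : ℂ) / 4) * ρ)) / expSubExpNeg (rsLineDown c t)))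
      ((volume.restrict (Ioi 0)).prod volume) := by
  have hc2 : |c| ≤ 2 := abs_le.2 ⟨by linarith [hc.1], by linarith [hc.2]⟩
  have hn := ne_intCast_of_mem_Ioo (m := 0) (by simpa using hc)
  have hk : Integrable fun t : ℝ => Complex.exp (-(I * (π : ℂ) * rsLineDown c t ^ 2)) /
      expSubExpNeg (rsLineDown c t) := by
    simpa using integrable_mordell hc2 hn 0
  have hcpos : 0 < √2 * π * c := mul_pos (by positivity) hc.1
  have hcont := continuous_rsLineDown c
  refine Integrable.mono' ((integrableOn_rpow_mul_exp_neg ha hcpos).mul_prod hk.norm) ?_ ?_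
  · have h1 : AEStronglyMeasurable (fun ρ : ℝ => (ρ : ℂ) ^ (a - 1)) (volume.restrict (Ioi 0)) :=
      (continuousOn_ofReal_cpow _).aestronglyMeasurable measurableSet_Ioi
    have h2 : Continuous fun p : ℝ × ℝ => Complex.exp (2 * (π : ℂ) * I *
        rsLineDown c p.2 * (Complex.exp (I * (π : ℂ) / 4) * p.1)) := by fun_prop
    refine (h1.comp_fst.mul (hk.aestronglyMeasurable.comp_snd.mul h2.aestronglyMeasurable)).congr
      (Eventually.of_forall fun p => ?_)
    simp only [Function.uncurry, Pi.mul_apply]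
    ring
  · have hae : ∀ᵐ p : ℝ × ℝ ∂(volume.restrict (Ioi 0)).prod volume, p.1 ∈ Ioi (0 : ℝ) :=
      Measure.quasiMeasurePreserving_fst.ae (ae_restrict_mem measurableSet_Ioi)
    filter_upwards [hae] with p hp
    have h3 : ‖Complex.exp (2 * (π : ℂ) * I * rsLineDown c p.2 *
        (Complex.exp (I * (π : ℂ) / 4) * p.1))‖ = Real.exp (-(√2 * π * c) * p.1) := by
      have h4 : 2 * (π : ℂ) * I * rsLineDown c p.2 * (Complex.exp (I * (π : ℂ) / 4) * p.1) =
          ((-(2 * π * p.1) : ℝ) : ℂ) * (Complex.exp (-(I * (π : ℂ) / 4)) * rsLineDown c p.2) := by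
        push_cast
        linear_combination (2 * π * rsLineDown c p.2 * p.1 : ℂ) * I_mul_exp_I_pi_div_four
      rw [h4, Complex.norm_exp, Complex.re_ofReal_mul, exp_neg_I_pi_div_four_mul_rsLineDown_re]
      congr 1
      ring
    simp only [Function.uncurry]
    rw [norm_mul, norm_div, norm_mul, h3, Complex.norm_cpow_eq_rpow_re_of_pos hp, norm_div,
      Complex.sub_re, Complex.one_re]
    exact le_of_eq (by ring)

lemma integral_cpow_mul_mordellIntegral {c : ℝ} (hc : c ∈ Ioo (0 : ℝ) 1) {a : ℂ}
    (ha : 0 < a.re) :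
    ∫ ρ : ℝ in Ioi 0, (ρ : ℂ) ^ (a - 1) * mordellIntegral c (Complex.exp (I * (π : ℂ) / 4) * ρ) =
      mellinFactor a * ∫ t : ℝ, Complex.exp (-(I * (π : ℂ) * rsLineDown c t ^ 2)) *
        rsLineDown c t ^ (-a) / expSubExpNeg (rsLineDown c t) := by
  simp_rw [mordellIntegral, ← integral_const_mul]
  rw [integral_integral_swap (integrable_prod_mordell hc ha)]
  refine integral_congr_ae (Eventually.of_forall fun t => ?_)
  have hu : 0 < (Complex.exp (-(I * (π : ℂ) / 4)) * rsLineDown c t).re := by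
    rw [exp_neg_I_pi_div_four_mul_rsLineDown_re]
    exact mul_pos (by positivity) hc.1
  have h1 : ∀ ρ : ℝ, (ρ : ℂ) ^ (a - 1) *
      (Complex.exp (-(I * (π : ℂ) * rsLineDown c t ^ 2)) * Complex.exp (2 * (π : ℂ) * I *
        rsLineDown c t * (Complex.exp (I * (π : ℂ) / 4) * ρ)) / expSubExpNeg (rsLineDown c t)) =
      Complex.exp (-(I * (π : ℂ) * rsLineDown c t ^ 2)) / expSubExpNeg (rsLineDown c t) *
        ((ρ : ℂ) ^ (a - 1) * Complex.exp (-(((2 * π : ℝ) : ℂ) *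
          (Complex.exp (-(I * (π : ℂ) / 4)) * rsLineDown c t) * ρ))) := by
    intro ρ
    have h2 : 2 * (π : ℂ) * I * rsLineDown c t * (Complex.exp (I * (π : ℂ) / 4) * ρ) =
        -(((2 * π : ℝ) : ℂ) * (Complex.exp (-(I * (π : ℂ) / 4)) * rsLineDown c t) * ρ) := by
      push_cast
      linear_combination (2 * π * rsLineDown c t * ρ : ℂ) * I_mul_exp_I_pi_div_four
    rw [h2]
    ring
  simp_rw [h1]
  rw [integral_const_mul, integral_cpow_mul_exp_two_pi_mul ha hu]
  ring

lemma expSubExpNeg_exp_I_mul_ne_zero {ρ : ℝ} (hρ : ρ ≠ 0) :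
    expSubExpNeg (Complex.exp (I * (π : ℂ) / 4) * ρ) ≠ 0 := by
  intro h
  obtain ⟨n, hn⟩ := expSubExpNeg_eq_zero_iff.1 h
  have h1 := congrArg Complex.im hn
  rw [Complex.im_mul_ofReal, exp_I_pi_div_four, Complex.intCast_im] at h1
  simp [hρ] at h1

/-- Riemann's relation: the Mellin transform of `e^{iπy²} / (2i sin(πy))` along `e^{iπ/4} ℝ₊`
in terms of `ζ` and the integral along `rsLineDown c`. -/
theorem integral_cpow_mul_exp_sq_div {c : ℝ} (hc : c ∈ Ioo (0 : ℝ) 1) {a : ℂ} (ha : 1 < a.re) :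
    ∫ ρ : ℝ in Ioi 0, (ρ : ℂ) ^ (a - 1) *
      (Complex.exp (I * (π : ℂ) * (Complex.exp (I * (π : ℂ) / 4) * ρ) ^ 2) /
        expSubExpNeg (Complex.exp (I * (π : ℂ) / 4) * ρ)) =
      mellinFactor a * (Complex.exp (-(I * (π : ℂ) / 4)) *
        (∫ t : ℝ, Complex.exp (-(I * (π : ℂ) * rsLineDown c t ^ 2)) *
          rsLineDown c t ^ (-a) / expSubExpNeg (rsLineDown c t)) - riemannZeta a) := by
  have ha0 : 0 < a.re := one_pos.trans ha
  have h1 : IntegrableOn (fun ρ : ℝ => (ρ : ℂ) ^ (a - 1) *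
      mordellIntegral c (Complex.exp (I * (π : ℂ) / 4) * ρ)) (Ioi 0) := by
    simp_rw [mordellIntegral, ← integral_const_mul]
    exact (integrable_prod_mordell hc ha0).integral_prod_left
  have h2 : ∀ ρ ∈ Ioi (0 : ℝ), (ρ : ℂ) ^ (a - 1) *
      (Complex.exp (I * (π : ℂ) * (Complex.exp (I * (π : ℂ) / 4) * ρ) ^ 2) /
        expSubExpNeg (Complex.exp (I * (π : ℂ) / 4) * ρ)) =
      Complex.exp (-(I * (π : ℂ) / 4)) * ((ρ : ℂ) ^ (a - 1) *
        mordellIntegral c (Complex.exp (I * (π : ℂ) / 4) * ρ)) - (ρ : ℂ) ^ (a - 1) *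
      (1 / (Complex.exp (((2 * π : ℝ) : ℂ) * Complex.exp (-(I * (π : ℂ) / 4)) * ρ) - 1)) := by
    intro ρ hρ
    have hρ' : 0 < ρ := hρ
    have h3 := mordellIntegral_eq hc (expSubExpNeg_exp_I_mul_ne_zero hρ'.ne')
    have h4 : -(2 * (π : ℂ) * I * (Complex.exp (I * (π : ℂ) / 4) * ρ)) =
        ((2 * π : ℝ) : ℂ) * Complex.exp (-(I * (π : ℂ) / 4)) * ρ := by
      push_cast
      linear_combination -(2 * π * ρ : ℂ) * I_mul_exp_I_pi_div_four
    rw [h4] at h3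
    linear_combination -(ρ : ℂ) ^ (a - 1) * h3
  rw [setIntegral_congr_fun measurableSet_Ioi h2, integral_sub (h1.const_mul _)
    (integrableOn_cpow_mul_one_div_exp_sub_one ha), integral_const_mul,
    integral_cpow_mul_mordellIntegral hc ha0, integral_cpow_mul_one_div_exp_sub_one ha]
  ring

lemma rsLineUp_mem_slitPlane {c t : ℝ} (hc : 0 ≤ c) (h : rsLineUp c t ≠ 0) :
    rsLineUp c t ∈ Complex.slitPlane := by
  rw [Complex.mem_slitPlane_iff, rsLineUp_re, rsLineUp_im]
  by_cases ht : t = 0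
  · left
    subst ht
    rcases hc.eq_or_lt with rfl | hc'
    · simp [rsLineUp] at h
    · simpa using hc'
  · right
    simp [ht]

lemma expSubExpNeg_rsLineUp_ne_zero_of_ne {c t : ℝ} (hc : c ∈ Ico (0 : ℝ) 1)
    (h : rsLineUp c t ≠ 0) : expSubExpNeg (rsLineUp c t) ≠ 0 := by
  intro h0
  obtain ⟨n, hn⟩ := expSubExpNeg_eq_zero_iff.1 h0
  have h1 := congrArg Complex.im hn
  have h2 := congrArg Complex.re hn
  rw [rsLineUp_im, Complex.intCast_im] at h1
  rw [rsLineUp_re, h1, Complex.intCast_re, add_zero] at h2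
  rw [h2] at hc
  have h3 : 0 ≤ n := by exact_mod_cast hc.1
  have h4 : n < 1 := by exact_mod_cast hc.2
  obtain rfl : n = 0 := by omega
  exact h (by simpa using hn)

/-- The integrand `e^{iπw²} w^{b} / (e^{iπw} - e^{-iπw})` of the first contour integral. -/
noncomputable def rsKernelUp (b w : ℂ) : ℂ :=
  Complex.exp (I * (π : ℂ) * w ^ 2) * w ^ b / expSubExpNeg w

lemma differentiableAt_rsKernelUp (b : ℂ) {w : ℂ} (hw : w ∈ Complex.slitPlane)
    (hD : expSubExpNeg w ≠ 0) : DifferentiableAt ℂ (rsKernelUp b) w := by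
  have h1 : DifferentiableAt ℂ (fun w : ℂ => w ^ b) w := differentiableAt_id.cpow_const hw
  have h2 : DifferentiableAt ℂ (fun w : ℂ => Complex.exp (I * (π : ℂ) * w ^ 2)) w := by fun_prop
  exact (h2.mul h1).div (differentiable_expSubExpNeg w) hD

lemma continuousAt_rsKernelUp_zero {b : ℂ} (hb : 1 < b.re) : ContinuousAt (rsKernelUp b) 0 := by
  have hpi : (π : ℂ) ≠ 0 := by exact_mod_cast Real.pi_ne_zero
  have hb0 : b ≠ 0 := by rintro rfl; simp at hb; linarith
  have hb1 : b - 1 ≠ 0 := by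
    intro h
    rw [sub_eq_zero.1 h] at hb
    simp at hb
  have hD0 : expSubExpNeg 0 = 0 := expSubExpNeg_eq_zero_iff.2 ⟨0, by simp⟩
  have h1 : rsKernelUp b = fun w => Complex.exp (I * (π : ℂ) * w ^ 2) * w ^ (b - 1) /
      dslope expSubExpNeg 0 w := by
    funext w
    by_cases hw : w = 0
    · simp [rsKernelUp, hw, Complex.zero_cpow hb0, Complex.zero_cpow hb1]
    · rw [rsKernelUp, dslope_of_ne _ hw, slope_def_field, hD0, sub_zero, sub_zero,
        Complex.cpow_sub _ _ hw, Complex.cpow_one]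
      field_simp
  rw [h1]
  refine ContinuousAt.div (ContinuousAt.mul (by fun_prop)
    (Complex.continuousAt_cpow_const_of_re_pos (Or.inl (by simp)) (by simpa using hb)))
    (continuousAt_dslope_same.2 (differentiable_expSubExpNeg 0)) ?_
  rw [dslope_same, deriv_expSubExpNeg]
  norm_num [hpi]

lemma continuousAt_rsKernelUp {b : ℂ} (hb : 1 < b.re) {c t : ℝ} (hc : c ∈ Ico (0 : ℝ) 1) :
    ContinuousAt (rsKernelUp b) (rsLineUp c t) := by
  by_cases h : rsLineUp c t = 0
  · rw [h]
    exact continuousAt_rsKernelUp_zero hb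
  · exact (differentiableAt_rsKernelUp b (rsLineUp_mem_slitPlane hc.1 h)
      (expSubExpNeg_rsLineUp_ne_zero_of_ne hc h)).continuousAt

lemma norm_rsKernelUp_le (b : ℂ) {c t : ℝ} (hc : |c| ≤ 2) (ht : 1 ≤ |t|) :
    ‖rsKernelUp b (rsLineUp c t)‖ ≤
      Real.exp (‖b‖ * 8) * Real.exp ((‖b‖ + 10) ^ 2) * Real.exp (-|t|) := by
  refine norm_kernel_le hc ht (norm_exp_sq_rsLineUp c t) ?_ (abs_rsLineUp_im c t)
  have hw : rsLineUp c t ≠ 0 := by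
    intro h
    have h2 := abs_rsLineUp_im c t
    rw [h] at h2
    have := half_le_sqrt_two_div_two_mul ht
    rw [← h2] at this
    norm_num at this
  refine (norm_cpow_le_exp_s6 hw b).trans ?_
  rw [← Real.exp_add, ← mul_add, Real.exp_le_exp]
  refine mul_le_mul_of_nonneg_left ?_ (norm_nonneg b)
  linarith [norm_log_le_of_abs_im hc ht (abs_rsLineUp_im c t) (norm_rsLineUp_le c t)]

lemma integral_rsKernelUp_eq_zero_line {b : ℂ} (hb : 1 < b.re) {c : ℝ} (hc : c ∈ Ioo (0 : ℝ) 1) :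
    ∫ t : ℝ, rsKernelUp b (rsLineUp c t) = ∫ t : ℝ, rsKernelUp b (rsLineUp 0 t) := by
  have hsub : ∀ c' ∈ Icc 0 c, c' ∈ Ico (0 : ℝ) 1 := fun c' hc' =>
    ⟨hc'.1, hc'.2.trans_lt hc.2⟩
  refine (integral_parallel_lines_eq norm_exp_I_pi_div_four hc.1.le (countable_singleton (0 : ℂ))
    (fun c' hc' t => continuousAt_rsKernelUp hb (hsub c' hc')) (fun c' hc' t ht => ?_)
    fun c' hc' t ht => norm_rsKernelUp_le b ?_ ht).symm
  · exact differentiableAt_rsKernelUp b (rsLineUp_mem_slitPlane hc'.1 ht)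
      (expSubExpNeg_rsLineUp_ne_zero_of_ne (hsub c' hc') ht)
  · exact abs_le.2 ⟨by linarith [hc'.1], by linarith [(hsub c' hc').2]⟩

lemma integrable_rsKernelUp_zero {b : ℂ} (hb : 1 < b.re) :
    Integrable fun t : ℝ => rsKernelUp b (rsLineUp 0 t) :=
  integrable_of_norm_le_exp_neg_abs (continuous_iff_continuousAt.2 fun t =>
    ContinuousAt.comp (g := rsKernelUp b) (continuousAt_rsKernelUp hb ⟨le_rfl, one_pos⟩)
      (continuous_rsLineUp 0).continuousAt)
    fun _ ht => norm_rsKernelUp_le b (by norm_num) ht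

lemma rsKernelUp_zero_of_pos (b : ℂ) {ρ : ℝ} (hρ : 0 < ρ) : rsKernelUp b (rsLineUp 0 ρ) =
    Complex.exp (I * (π : ℂ) / 4 * b) * ((ρ : ℂ) ^ b *
      (Complex.exp (I * (π : ℂ) * (Complex.exp (I * (π : ℂ) / 4) * ρ) ^ 2) /
        expSubExpNeg (Complex.exp (I * (π : ℂ) / 4) * ρ))) := by
  have hpi := Real.pi_pos
  have h1 : (Complex.exp (I * (π : ℂ) / 4) * ρ) ^ b =
      (ρ : ℂ) ^ b * Complex.exp (I * (π : ℂ) / 4 * b) := by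
    rw [mul_comm, ofReal_mul_cpow hρ (Complex.exp_ne_zero _),
      show I * (π : ℂ) / 4 = (π / 4 : ℝ) * I by push_cast; ring,
      exp_mul_I_cpow ⟨by linarith, by linarith⟩]
  rw [rsLineUp, Complex.ofReal_zero, zero_add, rsKernelUp, h1]
  ring

lemma rsKernelUp_zero_neg (b : ℂ) {ρ : ℝ} (hρ : 0 < ρ) : rsKernelUp b (rsLineUp 0 (-ρ)) =
    -Complex.exp (-(3 * (I * (π : ℂ) / 4) * b)) * ((ρ : ℂ) ^ b *
      (Complex.exp (I * (π : ℂ) * (Complex.exp (I * (π : ℂ) / 4) * ρ) ^ 2) /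
        expSubExpNeg (Complex.exp (I * (π : ℂ) / 4) * ρ))) := by
  have hpi := Real.pi_pos
  have h0 : -(Complex.exp (I * (π : ℂ) / 4) * ρ) = ρ * Complex.exp ((-(3 * (π / 4)) : ℝ) * I) := by
    rw [show I * (π : ℂ) / 4 = (-(3 * (π / 4)) : ℝ) * I + I * π by push_cast; ring,
      Complex.exp_add, exp_I_mul_pi]
    ring
  have h1 : (-(Complex.exp (I * (π : ℂ) / 4) * ρ)) ^ b =
      (ρ : ℂ) ^ b * Complex.exp (-(3 * (I * (π : ℂ) / 4) * b)) := by
    rw [h0, ofReal_mul_cpow hρ (Complex.exp_ne_zero _),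
      exp_mul_I_cpow ⟨by linarith, by linarith⟩]
    congr 2
    push_cast
    ring
  rw [rsLineUp, Complex.ofReal_zero, zero_add, Complex.ofReal_neg, mul_neg, rsKernelUp, h1,
    expSubExpNeg_neg, neg_sq]
  ring

lemma integral_rsKernelUp_zero {b : ℂ} (hb : 1 < b.re) :
    ∫ t : ℝ, rsKernelUp b (rsLineUp 0 t) =
      (Complex.exp (I * (π : ℂ) / 4 * b) - Complex.exp (-(3 * (I * (π : ℂ) / 4) * b))) *
      ∫ ρ : ℝ in Ioi 0, (ρ : ℂ) ^ b *
        (Complex.exp (I * (π : ℂ) * (Complex.exp (I * (π : ℂ) / 4) * ρ) ^ 2) /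
          expSubExpNeg (Complex.exp (I * (π : ℂ) / 4) * ρ)) := by
  have hint := integrable_rsKernelUp_zero hb
  have hneg := integral_comp_neg_Ioi 0 fun t => rsKernelUp b (rsLineUp 0 t)
  rw [neg_zero] at hneg
  rw [← intervalIntegral.integral_Iic_add_Ioi hint.integrableOn hint.integrableOn (b := 0),
    ← hneg, setIntegral_congr_fun measurableSet_Ioi fun ρ hρ => rsKernelUp_zero_neg b hρ,
    setIntegral_congr_fun measurableSet_Ioi fun ρ hρ => rsKernelUp_zero_of_pos b hρ,
    integral_const_mul, integral_const_mul]
  ring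

/-- The formula on the half-plane where the first contour may be moved through the origin. -/
theorem riemannZeta_one_sub_eq_of_two_lt_re {a : ℂ} (ha : 2 < a.re) {c₁ c₂ : ℝ}
    (hc₁ : c₁ ∈ Ioo (0 : ℝ) 1) (hc₂ : c₂ ∈ Ioo (0 : ℝ) 1) :
    riemannZeta (1 - a) =
      -(Complex.exp (I * (π : ℂ) / 4) * ∫ t : ℝ, rsKernelUp (a - 1) (rsLineUp c₁ t)) +
      Complex.Gammaℂ a * Complex.cos (π * a / 2) * (Complex.exp (-(I * (π : ℂ) / 4)) *
        ∫ t : ℝ, Complex.exp (-(I * (π : ℂ) * rsLineDown c₂ t ^ 2)) *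
          rsLineDown c₂ t ^ (-a) / expSubExpNeg (rsLineDown c₂ t)) := by
  have hb : 1 < (a - 1).re := by rw [Complex.sub_re, Complex.one_re]; linarith
  have ha' : ∀ n : ℕ, a ≠ -n := by
    rintro n rfl
    simp at ha
    linarith [n.cast_nonneg (α := ℝ)]
  have ha1 : a ≠ 1 := by rintro rfl; simp at ha
  rw [riemannZeta_one_sub ha' ha1, integral_rsKernelUp_eq_zero_line hb hc₁,
    integral_rsKernelUp_zero hb, integral_cpow_mul_exp_sq_div hc₂ (by linarith), mellinFactor,
    Complex.Gammaℂ_def]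
  set J := Complex.exp (-(I * (π : ℂ) / 4)) * _ with hJ
  have h1 : Complex.exp (I * (π : ℂ) / 4) * (Complex.exp (I * (π : ℂ) / 4 * (a - 1)) -
      Complex.exp (-(3 * (I * (π : ℂ) / 4) * (a - 1)))) * Complex.exp (I * (π : ℂ) / 4 * a) =
      2 * Complex.cos (π * a / 2) := by
    have h2 : Complex.exp (I * (π : ℂ) / 4) * Complex.exp (I * (π : ℂ) / 4 * (a - 1)) *
        Complex.exp (I * (π : ℂ) / 4 * a) = Complex.exp (π * a / 2 * I) := by
      rw [← Complex.exp_add, ← Complex.exp_add]; congr 1; ring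
    have h3 : Complex.exp (I * (π : ℂ) / 4) * Complex.exp (-(3 * (I * (π : ℂ) / 4) * (a - 1))) *
        Complex.exp (I * (π : ℂ) / 4 * a) = -Complex.exp (-(π * a / 2) * I) := by
      rw [← Complex.exp_add, ← Complex.exp_add, ← mul_neg_one (Complex.exp (-(π * a / 2) * I)),
        ← exp_I_mul_pi, ← Complex.exp_add]
      congr 1
      ring
    rw [Complex.cos, mul_div_cancel₀ _ two_ne_zero]
    linear_combination h2 - h3
  push_cast
  linear_combination (Complex.Gamma a * (2 * (π : ℂ)) ^ (-a) * (J - riemannZeta a)) * h1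

lemma norm_div_expSubExpNeg_le {G w : ℂ} {t : ℝ} (ht : 1 ≤ |t|) (him : |w.im| = √2 / 2 * |t|) :
    ‖G / expSubExpNeg w‖ ≤ ‖G‖ := by
  rw [norm_div]
  exact div_le_self (norm_nonneg G)
    (one_le_norm_expSubExpNeg (him ▸ half_le_sqrt_two_div_two_mul ht))

lemma rsLineDown_mem_slitPlane {c : ℝ} (hc : 0 < c) (t : ℝ) :
    rsLineDown c t ∈ Complex.slitPlane := by
  rw [Complex.mem_slitPlane_iff, rsLineDown_re, rsLineDown_im]
  by_cases ht : t = 0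
  · left
    simpa [ht] using hc
  · right
    simp [ht]

lemma rsLineUp_ne_zero {c : ℝ} (hc : c ≠ 0) (t : ℝ) : rsLineUp c t ≠ 0 := by
  intro h
  have h1 := congrArg Complex.re h
  have h2 := congrArg Complex.im h
  rw [rsLineUp_re, Complex.zero_re] at h1
  rw [rsLineUp_im, Complex.zero_im] at h2
  exact hc (by linarith)

lemma differentiable_integral_rsKernelUp {c : ℝ} (hc : c ∈ Ioo (0 : ℝ) 1) :
    Differentiable ℂ fun b => ∫ t : ℝ, rsKernelUp b (rsLineUp c t) := by
  have hc2 : |c| ≤ 2 := abs_le.2 ⟨by linarith [hc.1], by linarith [hc.2]⟩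
  have hn := ne_intCast_of_mem_Ioo (m := 0) (by simpa using hc)
  have hw := rsLineUp_ne_zero hc.1.ne'
  have hcont := continuous_rsLineUp c
  have hD := continuous_expSubExpNeg
  have h := differentiable_integral_gaussian_kernel hc2
    (g := fun t => Complex.exp (I * (π : ℂ) * rsLineUp c t ^ 2) / expSubExpNeg (rsLineUp c t))
    (L := fun t => Complex.log (rsLineUp c t))
    (Continuous.div (by fun_prop) (by fun_prop) fun t => expSubExpNeg_rsLineUp_ne_zero hn)
    (hcont.clog fun t => rsLineUp_mem_slitPlane hc.1.le (hw t))
    (fun t ht => (norm_div_expSubExpNeg_le ht (abs_rsLineUp_im c t)).trans_eq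
      (norm_exp_sq_rsLineUp c t))
    (fun t ht => norm_log_le_of_abs_im hc2 ht (abs_rsLineUp_im c t) (norm_rsLineUp_le c t))
  refine (congrArg (Differentiable ℂ) (funext fun b => integral_congr_ae
    (Eventually.of_forall fun t => ?_))).mp h
  rw [rsKernelUp, Complex.cpow_def_of_ne_zero (hw t), mul_comm (Complex.log _)]
  ring

lemma differentiable_integral_rsLineDown {c : ℝ} (hc : c ∈ Ioo (0 : ℝ) 1) :
    Differentiable ℂ fun b : ℂ => ∫ t : ℝ, Complex.exp (-(I * (π : ℂ) * rsLineDown c t ^ 2)) *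
      rsLineDown c t ^ b / expSubExpNeg (rsLineDown c t) := by
  have hc2 : |c| ≤ 2 := abs_le.2 ⟨by linarith [hc.1], by linarith [hc.2]⟩
  have hn := ne_intCast_of_mem_Ioo (m := 0) (by simpa using hc)
  have hw := rsLineDown_ne_zero hc.1.ne'
  have hcont := continuous_rsLineDown c
  have hD := continuous_expSubExpNeg
  have h := differentiable_integral_gaussian_kernel hc2
    (g := fun t => Complex.exp (-(I * (π : ℂ) * rsLineDown c t ^ 2)) /
      expSubExpNeg (rsLineDown c t))
    (L := fun t => Complex.log (rsLineDown c t))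
    (Continuous.div (by fun_prop) (by fun_prop) fun t => expSubExpNeg_rsLineDown_ne_zero hn)
    (hcont.clog fun t => rsLineDown_mem_slitPlane hc.1 t)
    (fun t ht => (norm_div_expSubExpNeg_le ht (abs_rsLineDown_im c t)).trans_eq
      (norm_exp_sq_rsLineDown c t))
    (fun t ht => norm_log_le_of_abs_im hc2 ht (abs_rsLineDown_im c t) (norm_rsLineDown_le c t))
  refine (congrArg (Differentiable ℂ) (funext fun b => integral_congr_ae
    (Eventually.of_forall fun t => ?_))).mp h
  rw [Complex.cpow_def_of_ne_zero (hw t), mul_comm (Complex.log _)]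
  ring

/-- The Riemann–Siegel formula with the Gamma factors cleared, valid for all `s ≠ 1`. -/
theorem inv_Gammaℝ_mul_riemannZeta_sub {c₁ c₂ : ℝ} (hc₁ : c₁ ∈ Ioo (0 : ℝ) 1)
    (hc₂ : c₂ ∈ Ioo (0 : ℝ) 1) {s : ℂ} (hs : s ≠ 1) :
    (Complex.Gammaℝ (1 - s))⁻¹ * (riemannZeta s +
      Complex.exp (I * (π : ℂ) / 4) * ∫ t : ℝ, rsKernelUp (-s) (rsLineUp c₁ t)) =
    (Complex.Gammaℝ s)⁻¹ * (Complex.exp (-(I * (π : ℂ) / 4)) *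
      ∫ t : ℝ, Complex.exp (-(I * (π : ℂ) * rsLineDown c₂ t ^ 2)) *
        rsLineDown c₂ t ^ (s - 1) / expSubExpNeg (rsLineDown c₂ t)) := by
  have hopen : IsOpen ({1}ᶜ : Set ℂ) := isOpen_compl_singleton
  have hinv := Complex.differentiable_Gammaℝ_inv
  have hup := differentiable_integral_rsKernelUp hc₁
  have hdown := differentiable_integral_rsLineDown hc₂
  have hf : AnalyticOnNhd ℂ (fun s : ℂ => (Complex.Gammaℝ (1 - s))⁻¹ * (riemannZeta s +
      Complex.exp (I * (π : ℂ) / 4) * ∫ t : ℝ, rsKernelUp (-s) (rsLineUp c₁ t))) {1}ᶜ := by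
    refine DifferentiableOn.analyticOnNhd (fun z hz => ?_) hopen
    exact ((hinv.comp (differentiable_id.const_sub 1) z).mul ((differentiableAt_riemannZeta hz).add
      ((hup.comp differentiable_neg z).const_mul _))).differentiableWithinAt
  have hg : AnalyticOnNhd ℂ (fun s : ℂ => (Complex.Gammaℝ s)⁻¹ *
      (Complex.exp (-(I * (π : ℂ) / 4)) *
      ∫ t : ℝ, Complex.exp (-(I * (π : ℂ) * rsLineDown c₂ t ^ 2)) *
        rsLineDown c₂ t ^ (s - 1) / expSubExpNeg (rsLineDown c₂ t))) {1}ᶜ := by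
    refine DifferentiableOn.analyticOnNhd (fun z _ => ?_) hopen
    exact ((hinv z).mul ((hdown.comp (differentiable_id.sub_const 1) z).const_mul
      _)).differentiableWithinAt
  refine hf.eqOn_of_preconnected_of_eventuallyEq hg
    (isConnected_compl_singleton_of_one_lt_rank (by simp) 1).isPreconnected
    (z₀ := -2) (by norm_num) ?_ hs
  have hnhds : {z : ℂ | z.re < -1} ∈ 𝓝 (-2 : ℂ) :=
    (isOpen_lt Complex.continuous_re continuous_const).mem_nhds (by simp)
  filter_upwards [hnhds] with z hz
  have hz' : z.re < -1 := hz
  have ha : 2 < (1 - z).re := by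
    rw [Complex.sub_re, Complex.one_re]
    linarith
  have h1 := riemannZeta_one_sub_eq_of_two_lt_re ha hc₁ hc₂
  have h2 := Complex.inv_Gammaℝ_one_sub (s := 1 - z) fun n h => by
    rw [h, Complex.neg_re, Complex.natCast_re] at ha
    linarith [n.cast_nonneg (α := ℝ)]
  rw [sub_sub_cancel] at h1 h2
  rw [h1, h2, show 1 - z - 1 = -z by ring, neg_sub]
  ring

end

/-- **Riemann–Siegel integral formula for the Riemann zeta function.**
For `s ≠ 1` not an odd positive integer and any crossing points `c₁, c₂ ∈ (0,1)`,
`ζ(s) = ∫_{0 ↙ 1} e^{iπw²} w^{-s}/(e^{iπw} - e^{-iπw}) dw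
  + π^{s-1/2} (Γ((1-s)/2)/Γ(s/2)) ∫_{0 ↘ 1} e^{-iπw²} w^{s-1}/(e^{iπw} - e^{-iπw}) dw`,
where the first contour is the line `w₁(t) = c₁ + e^{iπ/4}t` traversed downward
(hence the sign `-e^{iπ/4}`) and the second is `w₂(t) = c₂ + e^{-iπ/4}t`. -/
theorem riemann_siegel_integral_formula (s : ℂ) (hs1 : s ≠ 1)
    (hodd : ∀ k : ℕ, s ≠ 2 * (k : ℂ) + 1) (c₁ c₂ : ℝ)
    (hc₁ : c₁ ∈ Ioo (0:ℝ) 1) (hc₂ : c₂ ∈ Ioo (0:ℝ) 1) :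
    riemannZeta s
      = -(Complex.exp (I * (π : ℂ) / 4) *
            ∫ t : ℝ,
              Complex.exp (I * (π : ℂ) * (rsLineUp c₁ t) ^ 2) * (rsLineUp c₁ t) ^ (-s) /
                (Complex.exp (I * (π : ℂ) * rsLineUp c₁ t)
                  - Complex.exp (-(I * (π : ℂ) * rsLineUp c₁ t))))
        + (π : ℂ) ^ (s - 1/2) * (Complex.Gamma ((1 - s) / 2) / Complex.Gamma (s / 2)) *
            (Complex.exp (-(I * (π : ℂ) / 4)) *
              ∫ t : ℝ,
                Complex.exp (-(I * (π : ℂ) * (rsLineDown c₂ t) ^ 2))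
                    * (rsLineDown c₂ t) ^ (s - 1) /
                  (Complex.exp (I * (π : ℂ) * rsLineDown c₂ t)
                    - Complex.exp (-(I * (π : ℂ) * rsLineDown c₂ t)))) := by
  have hG : Complex.Gammaℝ (1 - s) ≠ 0 := by
    rw [Ne, Complex.Gammaℝ_eq_zero_iff, not_exists]
    intro n hn
    exact hodd n (by linear_combination -hn)
  have hpi : (π : ℂ) ≠ 0 := by exact_mod_cast Real.pi_ne_zero
  have hmain := inv_Gammaℝ_mul_riemannZeta_sub hc₁ hc₂ hs1
  rw [inv_mul_eq_iff_eq_mul₀ hG, ← mul_assoc, ← div_eq_mul_inv] at hmain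
  have hfactor : Complex.Gammaℝ (1 - s) / Complex.Gammaℝ s =
      (π : ℂ) ^ (s - 1 / 2) * (Complex.Gamma ((1 - s) / 2) / Complex.Gamma (s / 2)) := by
    rw [Complex.Gammaℝ_def, Complex.Gammaℝ_def, mul_div_mul_comm, ← Complex.cpow_sub _ _ hpi]
    congr 2
    ring
  rw [hfactor] at hmain
  simp only [rsKernelUp, expSubExpNeg] at hmain
  linear_combination hmain
end
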